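/- arXiv:0810.3978 — 5 statements merged into one kernel-verified Lean document; each statement's English description precedes it below -/
import Mathlib

section
/- Let H be Haar-distributed on the orthogonal group O(n) with n ≥ 2. Then E(tr(H⁴)) = 1. -/
open Matrix MeasureTheory

lemma int5 {Ω : Type*} [MeasurableSpace Ω] (μ : Measure Ω) (r1 r2 r3 r4 r5 : ℝ)
    {f1 f2 f3 f4 f5 : Ω → ℝ} (h1 : Integrable f1 μ) (h2 : Integrable f2 μ) (h3 : Integrable f3 μ)
    (h4 : Integrable f4 μ) (h5 : Integrable f5 μ) :
    ∫ x, (r1 * f1 x + r2 * f2 x + r3 * f3 x + r4 * f4 x + r5 * f5 x) ∂μ =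
      r1 * (∫ x, f1 x ∂μ) + r2 * (∫ x, f2 x ∂μ) + r3 * (∫ x, f3 x ∂μ) + r4 * (∫ x, f4 x ∂μ)
        + r5 * (∫ x, f5 x ∂μ) := by
  simp only [← integral_const_mul]
  have k1 := h1.const_mul r1
  have k2 := h2.const_mul r2
  have k3 := h3.const_mul r3
  have k4 := h4.const_mul r4
  have k5 := h5.const_mul r5
  rw [← integral_add k1 k2, ← integral_add (by fun_prop) k3, ← integral_add (by fun_prop) k4,
    ← integral_add (by fun_prop) k5]

/-- Householder matrix of `α e_a + β e_b`. -/
noncomputable def reflMat {n : ℕ} (a b : Fin n) (α β t : ℝ) : Matrix (Fin n) (Fin n) ℝ :=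
  1 - t • vecMulVec (Pi.single a α + Pi.single b β) (Pi.single a α + Pi.single b β)

lemma reflMat_mem {n : ℕ} {a b : Fin n} (hab : a ≠ b) {α β t : ℝ} (h : t * (α ^ 2 + β ^ 2) = 2) :
    reflMat a b α β t ∈ Matrix.orthogonalGroup (Fin n) ℝ := by
  rw [Matrix.mem_orthogonalGroup_iff]
  have hT : (reflMat a b α β t)ᵀ = reflMat a b α β t := by
    simp [reflMat, transpose_vecMulVec]
  have hdot : (Pi.single a α + Pi.single b β : Fin n → ℝ) ⬝ᵥ (Pi.single a α + Pi.single b β)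
      = α ^ 2 + β ^ 2 := by
    simp [hab, hab.symm]; ring
  rw [hT]
  unfold reflMat
  generalize (Pi.single a α + Pi.single b β : Fin n → ℝ) = w at hdot
  have h2 : vecMulVec w w * vecMulVec w w = (α ^ 2 + β ^ 2) • vecMulVec w w := by
    rw [vecMulVec_mul_vecMulVec, hdot]
    ext i j; simp [vecMulVec_apply]; ring
  rw [sub_mul, mul_sub, mul_sub, smul_mul_smul_comm, h2, smul_smul]
  have : t * t * (α ^ 2 + β ^ 2) = 2 * t := by linear_combination t * h
  rw [this]
  simp only [one_mul, mul_one, mul_smul, two_smul]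
  abel

lemma reflMat_mul {n : ℕ} (a b : Fin n) (α β t : ℝ) (H : Matrix (Fin n) (Fin n) ℝ) (i j : Fin n) :
    (reflMat a b α β t * H) i j = H i j - t * ((Pi.single a α + Pi.single b β : Fin n → ℝ) i)
      * (α * H a j + β * H b j) := by
  simp only [reflMat, sub_mul, one_mul, smul_mul_assoc, vecMulVec_mul]
  simp [vecMulVec_apply, add_vecMul, mul_assoc]

section
variable {n : ℕ} [MeasurableSpace (Matrix.orthogonalGroup (Fin n) ℝ)]
    [BorelSpace (Matrix.orthogonalGroup (Fin n) ℝ)]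
    (μ : Measure (Matrix.orthogonalGroup (Fin n) ℝ))
    [μ.IsHaarMeasure] [IsProbabilityMeasure μ]

lemma int_refl {a b : Fin n} (hab : a ≠ b) {α β t : ℝ} (h : t * (α ^ 2 + β ^ 2) = 2)
    (f : Matrix (Fin n) (Fin n) ℝ → ℝ) :
    ∫ H, f (H : Matrix (Fin n) (Fin n) ℝ) ∂μ =
      ∫ H, f (Matrix.of fun i j => H.1 i j - t * ((Pi.single a α + Pi.single b β : Fin n → ℝ) i)
      * (α * H.1 a j + β * H.1 b j)) ∂μ := by
  rw [← integral_mul_left_eq_self _ (⟨_, reflMat_mem hab h⟩ : Matrix.orthogonalGroup (Fin n) ℝ)]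
  congr 1
  ext H
  congr 1
  ext i j
  exact reflMat_mul a b α β t H.1 i j

lemma int_swap {a b : Fin n} (hab : a ≠ b) (f : Matrix (Fin n) (Fin n) ℝ → ℝ) :
    ∫ H, f (H : Matrix (Fin n) (Fin n) ℝ) ∂μ =
      ∫ H, f (Matrix.of fun i j => H.1 (Equiv.swap a b i) j) ∂μ := by
  rw [int_refl μ hab (α := 1) (β := -1) (t := 1) (by norm_num)]
  congr 1
  ext H
  congr 1
  ext i j
  by_cases h1 : i = a
  · subst h1; simp [hab]
  · by_cases h2 : i = b
    · subst h2; simp [hab.symm]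
    · simp [h1, h2, Equiv.swap_apply_of_ne_of_ne]

lemma int_flip {a b : Fin n} (hab : a ≠ b) (f : Matrix (Fin n) (Fin n) ℝ → ℝ) :
    ∫ H, f (H : Matrix (Fin n) (Fin n) ℝ) ∂μ =
      ∫ H, f (Matrix.of fun i j => (if i = a then -1 else 1) * H.1 i j) ∂μ := by
  rw [int_refl μ hab (α := 1) (β := 0) (t := 2) (by norm_num)]
  congr 1
  ext H
  congr 1
  ext i j
  by_cases h1 : i = a
  · subst h1; simp; ring
  · simp [h1]

omit [BorelSpace (Matrix.orthogonalGroup (Fin n) ℝ)] [MeasurableSpace (Matrix.orthogonalGroup (Fin n) ℝ)] in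
lemma entry_le (H : Matrix.orthogonalGroup (Fin n) ℝ) (i j : Fin n) : ‖H.1 i j‖ ≤ 1 :=
  entry_norm_bound_of_unitary H.2 i j

omit [BorelSpace (Matrix.orthogonalGroup (Fin n) ℝ)] [MeasurableSpace (Matrix.orthogonalGroup (Fin n) ℝ)] in
lemma entry_cont (i j : Fin n) : Continuous fun H : Matrix.orthogonalGroup (Fin n) ℝ => H.1 i j :=
  (continuous_subtype_val).matrix_elem i j

lemma int2 (a b i j : Fin n) : Integrable
    (fun H : Matrix.orthogonalGroup (Fin n) ℝ => H.1 a i * H.1 b j) μ := by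
  refine Integrable.of_bound (C := 1)
    ((entry_cont a i).mul (entry_cont b j)).aestronglyMeasurable (.of_forall fun H => ?_)
  rw [norm_mul]
  exact mul_le_one₀ (entry_le H _ _) (norm_nonneg _) (entry_le H _ _)

lemma int4 (a b c d i j k l : Fin n) : Integrable
    (fun H : Matrix.orthogonalGroup (Fin n) ℝ => H.1 a i * H.1 b j * H.1 c k * H.1 d l) μ := by
  refine Integrable.of_bound (C := 1)
    ((((entry_cont a i).mul (entry_cont b j)).mul (entry_cont c k)).mul
      (entry_cont d l)).aestronglyMeasurable (.of_forall fun H => ?_)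
  rw [norm_mul, norm_mul, norm_mul]
  have := entry_le H
  exact mul_le_one₀ (mul_le_one₀ (mul_le_one₀ (this _ _) (norm_nonneg _) (this _ _))
    (norm_nonneg _) (this _ _)) (norm_nonneg _) (this _ _)

/-- fourth moments -/
noncomputable def M4 (a b c d i j k l : Fin n) : ℝ :=
  ∫ H, H.1 a i * H.1 b j * H.1 c k * H.1 d l ∂μ

lemma M4_flip (hn : 2 ≤ n) (x a b c d i j k l : Fin n) :
    M4 μ a b c d i j k l = (if a = x then -1 else 1) * (if b = x then -1 else 1) *
      (if c = x then -1 else 1) * (if d = x then -1 else 1) * M4 μ a b c d i j k l := by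
  haveI : Nontrivial (Fin n) := Fin.nontrivial_iff_two_le.2 hn
  obtain ⟨y, hy⟩ := exists_ne x
  conv_lhs => rw [M4, int_flip μ hy.symm (fun H => H a i * H b j * H c k * H d l)]
  rw [M4, ← integral_const_mul]
  congr 1
  ext H
  simp only [Matrix.of_apply]
  ring

lemma M4_zero (hn : 2 ≤ n) (a b c d i j k l : Fin n) (h1 : ¬ (a = b ∧ c = d))
    (h2 : ¬ (a = c ∧ b = d)) (h3 : ¬ (a = d ∧ b = c)) : M4 μ a b c d i j k l = 0 := by
  have ha := M4_flip μ hn a a b c d i j k l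
  have hb := M4_flip μ hn b a b c d i j k l
  have hc := M4_flip μ hn c a b c d i j k l
  have hd := M4_flip μ hn d a b c d i j k l
  generalize M4 μ a b c d i j k l = m at *
  grind

lemma M4_swap {x y : Fin n} (hxy : x ≠ y) (a b c d i j k l : Fin n) :
    M4 μ a b c d i j k l = M4 μ (Equiv.swap x y a) (Equiv.swap x y b) (Equiv.swap x y c)
      (Equiv.swap x y d) i j k l :=
  int_swap μ hxy (fun H => H a i * H b j * H c k * H d l)

lemma M4_rot (hn : 2 ≤ n) {a c : Fin n} (hac : a ≠ c) :
    M4 μ a a a a a a a a = 3 * M4 μ a a c c a a a a := by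
  have h := int_refl μ hac (α := 1) (β := 2) (t := 2/5) (by norm_num)
    (fun H => H a a * H a a * H a a * H a a)
  have hs := M4_swap μ hac a a a a a a a a
  have z1 := M4_zero μ hn a a a c a a a a (by tauto) (by tauto) (by tauto)
  have z2 := M4_zero μ hn a c c c a a a a (by tauto) (by tauto) (by tauto)
  simp only [Equiv.swap_apply_left] at hs
  have e : ∀ H : Matrix.orthogonalGroup (Fin n) ℝ,
     (fun H : Matrix (Fin n) (Fin n) ℝ => H a a * H a a * H a a * H a a)
      (Matrix.of fun i j => H.1 i j - 2/5 * ((Pi.single a 1 + Pi.single c 2 : Fin n → ℝ) i)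
      * (1 * H.1 a j + 2 * H.1 c j)) =
      (81/625) * (H.1 a a * H.1 a a * H.1 a a * H.1 a a)
      + (-432/625) * (H.1 a a * H.1 a a * H.1 a a * H.1 c a)
      + (864/625) * (H.1 a a * H.1 a a * H.1 c a * H.1 c a)
      + (-768/625) * (H.1 a a * H.1 c a * H.1 c a * H.1 c a)
      + (256/625) * (H.1 c a * H.1 c a * H.1 c a * H.1 c a) := by
    intro H
    simp [hac]
    ring
  simp_rw [e] at h
  rw [int5 μ _ _ _ _ _ (int4 μ _ _ _ _ _ _ _ _) (int4 μ _ _ _ _ _ _ _ _) (int4 μ _ _ _ _ _ _ _ _)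
    (int4 μ _ _ _ _ _ _ _ _) (int4 μ _ _ _ _ _ _ _ _)] at h
  change M4 μ a a a a a a a a = 81/625 * M4 μ a a a a a a a a + -432/625 * M4 μ a a a c a a a a
    + 864/625 * M4 μ a a c c a a a a + -768/625 * M4 μ a c c c a a a a
    + 256/625 * M4 μ c c c c a a a a at h
  rw [z1, z2, ← hs] at h
  linarith

omit [BorelSpace (Matrix.orthogonalGroup (Fin n) ℝ)] [MeasurableSpace (Matrix.orthogonalGroup (Fin n) ℝ)] in
lemma row_orth (H : Matrix.orthogonalGroup (Fin n) ℝ) (a c : Fin n) :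
    ∑ b, H.1 a b * H.1 c b = if a = c then 1 else 0 := by
  have := congrFun (congrFun ((Matrix.mem_orthogonalGroup_iff _ _).1 H.2) a) c
  simpa [Matrix.mul_apply, Matrix.one_apply, star_apply] using this

lemma X_sum {a c : Fin n} (hac : a ≠ c) : ∑ b, M4 μ a a c c a b b a = 0 := by
  simp only [M4]
  rw [← integral_finsetSum _ fun b _ => int4 μ a a c c a b b a]
  have : ∀ H : Matrix.orthogonalGroup (Fin n) ℝ,
      ∑ b, H.1 a a * H.1 a b * H.1 c b * H.1 c a = 0 := by
    intro H
    have := row_orth H a c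
    rw [if_neg hac] at this
    calc _ = H.1 a a * H.1 c a * ∑ b, H.1 a b * H.1 c b := by
          rw [Finset.mul_sum]; exact Finset.sum_congr rfl fun b _ => by ring
      _ = 0 := by rw [this, mul_zero]
  simp [this]

lemma Y_sum (a c : Fin n) :
    ∑ b, M4 μ a a c c a a b b = ∫ H, H.1 a a * H.1 a a ∂μ := by
  simp only [M4]
  rw [← integral_finsetSum _ fun b _ => int4 μ a a c c a a b b]
  congr 1
  ext H
  have := row_orth H c c
  rw [if_pos rfl] at this
  calc _ = H.1 a a * H.1 a a * ∑ b, H.1 c b * H.1 c b := by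
        rw [Finset.mul_sum]; exact Finset.sum_congr rfl fun b _ => by ring
    _ = _ := by rw [this, mul_one]

lemma M4_comm (a b c d i j k l : Fin n) : M4 μ a b c d i j k l = M4 μ a d c b i l k j := by
  simp only [M4]; congr 1; ext H; ring

lemma F1 {a c : Fin n} (b : Fin n) (hac : a ≠ c) (hb : b ≠ a) :
    M4 μ a a b b a b b a = M4 μ a a c c a b b a := by
  by_cases h : b = c
  · rw [h]
  · rw [M4_swap μ h]
    simp [Equiv.swap_apply_of_ne_of_ne hb.symm hac]

lemma F2 {a c : Fin n} (b : Fin n) (hac : a ≠ c) (hb : b ≠ a) :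
    M4 μ a b a b b a b a = M4 μ a a c c a a b b := by
  have h1 : M4 μ a b a b b a b a = M4 μ a a b b a a b b := by
    rw [M4_swap μ hb]
    simp only [Equiv.swap_apply_left, Equiv.swap_apply_right, M4]
    congr 1; ext H; ring
  rw [h1]
  by_cases h : b = c
  · rw [h]
  · rw [M4_swap μ h]
    simp [Equiv.swap_apply_of_ne_of_ne hb.symm hac]

lemma diag_term (hn : 2 ≤ n) {a c : Fin n} (hac : a ≠ c) :
    ∑ b, ∑ x, ∑ d, M4 μ a b x d b x d a = ∫ H, H.1 a a * H.1 a a ∂μ := by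
  have key : ∀ b x d, M4 μ a b x d b x d a =
      (if a = b then (if x = d then M4 μ a a x x a x x a else 0) else 0)
      + (if a = x then (if b = d then M4 μ a b a b b a b a else 0) else 0)
      + (if b = x then (if a = d then M4 μ a b b a b b a a else 0) else 0)
      - 2 * (if a = b then (if a = x then (if a = d then M4 μ a a a a a a a a else 0) else 0)
        else 0) := by
    intro b x d
    have := M4_zero μ hn a b x d b x d a
    by_cases h1 : a = b
    · subst h1
      by_cases h2 : a = x
      · subst h2
        by_cases h3 : a = d
        · subst h3; simp; ring
        · simp [h3]; grind
      · grind
    · grind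
  have e1 : ∀ x, M4 μ a a x x a x x a = M4 μ a a c c a x x a +
      if a = x then M4 μ a a a a a a a a - M4 μ a a c c a a a a else 0 := by
    intro x
    split_ifs with h
    · subst h; ring
    · rw [F1 μ x hac (Ne.symm h), add_zero]
  have e2 : ∀ x, M4 μ a x a x x a x a = M4 μ a a c c a a x x +
      if a = x then M4 μ a a a a a a a a - M4 μ a a c c a a a a else 0 := by
    intro x
    split_ifs with h
    · subst h; ring
    · rw [F2 μ x hac (Ne.symm h), add_zero]
  have e3 : ∀ x, M4 μ a x x a x x a a = M4 μ a a x x a x x a := by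
    intro x
    simp only [M4]; congr 1; ext H; ring
  have s1 : ∑ x, M4 μ a a x x a x x a = M4 μ a a a a a a a a - M4 μ a a c c a a a a := by
    rw [Finset.sum_congr rfl fun x _ => e1 x]
    rw [Finset.sum_add_distrib, X_sum μ hac]; simp
  have s2 : ∑ x, M4 μ a x a x x a x a = (∫ H, H.1 a a * H.1 a a ∂μ) +
      (M4 μ a a a a a a a a - M4 μ a a c c a a a a) := by
    rw [Finset.sum_congr rfl fun x _ => e2 x]
    rw [Finset.sum_add_distrib, Y_sum μ]; simp
  have hr := M4_rot μ hn hac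
  have : ∑ b, ∑ x, ∑ d, M4 μ a b x d b x d a =
      ∑ x, M4 μ a a x x a x x a + ∑ x, M4 μ a x a x x a x a + ∑ x, M4 μ a x x a x x a a
      - 2 * M4 μ a a a a a a a a := by
    rw [Finset.sum_congr rfl fun b _ => Finset.sum_congr rfl fun x _ =>
      Finset.sum_congr rfl fun d _ => key b x d]
    simp only [Finset.sum_add_distrib, Finset.sum_sub_distrib, ← Finset.mul_sum]
    congr 1
    · congr 1
      · congr 1
        · rw [Finset.sum_eq_single a (by intro b _ hb; simp [hb.symm]) (by simp)]
          simp
        · refine Finset.sum_congr rfl fun b _ => ?_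
          rw [Finset.sum_eq_single a (by intro b _ hb; simp [hb.symm]) (by simp)]
          simp
      · refine Finset.sum_congr rfl fun b _ => ?_
        rw [Finset.sum_eq_single b (by intro b _ hb; simp [hb.symm]) (by simp)]
        simp
    · rw [Finset.sum_eq_single a (by intro b _ hb; simp [hb.symm]) (by simp),
        Finset.sum_eq_single a (by intro b _ hb; simp [hb.symm]) (by simp)]
      simp
  rw [this]
  rw [Finset.sum_congr rfl fun x _ => e3 x]
  rw [s1, s2]
  linarith

lemma sec_moment (a c : Fin n) : ∫ H, H.1 a a * H.1 a a ∂μ = ∫ H, H.1 c a * H.1 c a ∂μ := by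
  by_cases h : a = c
  · rw [h]
  · rw [int_swap μ h (fun H => H a a * H a a)]
    simp

end

/-- For `H` Haar-distributed on `O(n)`, `n ≥ 2`: `E(tr(H⁴)) = 1`. -/
theorem haar_expect_trace_pow_four {n : ℕ} (hn : 2 ≤ n)
    [MeasurableSpace (Matrix.orthogonalGroup (Fin n) ℝ)]
    [BorelSpace (Matrix.orthogonalGroup (Fin n) ℝ)]
    (μ : Measure (Matrix.orthogonalGroup (Fin n) ℝ))
    [μ.IsHaarMeasure] [IsProbabilityMeasure μ] :
    ∫ H, Matrix.trace (((H : Matrix (Fin n) (Fin n) ℝ)) ^ 4) ∂μ = 1 := by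
  haveI : Nontrivial (Fin n) := Fin.nontrivial_iff_two_le.2 hn
  have e : ∀ H : Matrix (Fin n) (Fin n) ℝ, Matrix.trace (H ^ 4) =
      ∑ a, ∑ b, ∑ x, ∑ d, H a b * H b x * H x d * H d a := by
    intro H
    have : H ^ 4 = H * (H * (H * H)) := by noncomm_ring
    rw [this]
    simp only [Matrix.trace, Matrix.diag_apply, Matrix.mul_apply, Finset.mul_sum, mul_assoc]
  simp_rw [e]
  have I := int4 μ
  rw [integral_finsetSum _ fun a _ => integrable_finsetSum _ fun b _ =>
    integrable_finsetSum _ fun x _ => integrable_finsetSum _ fun d _ => I a b x d b x d a]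
  have : ∀ a : Fin n, ∫ H, ∑ b, ∑ x, ∑ d, H.1 a b * H.1 b x * H.1 x d * H.1 d a ∂μ =
      ∫ H, H.1 a a * H.1 a a ∂μ := by
    intro a
    obtain ⟨c, hc⟩ := exists_ne a
    rw [← diag_term μ hn hc.symm]
    rw [integral_finsetSum _ fun b _ =>
      integrable_finsetSum _ fun x _ => integrable_finsetSum _ fun d _ => I a b x d b x d a]
    refine Finset.sum_congr rfl fun b _ => ?_
    rw [integral_finsetSum _ fun x _ => integrable_finsetSum _ fun d _ => I a b x d b x d a]
    refine Finset.sum_congr rfl fun x _ => ?_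
    rw [integral_finsetSum _ fun d _ => I a b x d b x d a]
    rfl
  simp_rw [this]
  have c : Fin n := ⟨0, by omega⟩
  simp_rw [fun a => sec_moment μ a c]
  rw [← integral_finsetSum _ fun a _ => int2 μ c c a a]
  simp_rw [row_orth]
  simp
end

section
/- Let H be Haar-distributed on O(n), n ≥ 2, and let Z be the first k ≤ n columns of H. For fixed n×n symmetric matrices A and B, E(tr(Z'AZ)·tr(Z'BZ)) = [k(nk+k-2)·tr(A)·tr(B) + 2k(n-k)·tr(AB)] / (n(n-1)(n+2)). -/
open Matrix MeasureTheory

lemma aux_sign {n : ℕ} (m : Fin n) :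
    (diagonal (fun x => if x = m then (-1:ℝ) else 1)) ∈ Matrix.orthogonalGroup (Fin n) ℝ := by
  rw [Matrix.mem_orthogonalGroup_iff]
  rw [diagonal_transpose, diagonal_mul_diagonal, ← diagonal_one]
  congr 1; ext x; by_cases h : x = m <;> simp [h]

lemma aux_perm {n : ℕ} (σ : Equiv.Perm (Fin n)) :
    ((1 : Matrix (Fin n) (Fin n) ℝ).submatrix σ id) ∈ Matrix.orthogonalGroup (Fin n) ℝ := by
  rw [Matrix.mem_orthogonalGroup_iff]
  rw [transpose_submatrix, transpose_one,
    ← submatrix_mul _ _ _ _ _ Function.bijective_id]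
  simp

noncomputable def rotQ {n : ℕ} (i j : Fin n) : Matrix (Fin n) (Fin n) ℝ :=
  1 + single i i (√2/2 - 1) + single i j (√2/2) + single j i (√2/2) + single j j (-(√2/2) - 1)

lemma rotQ_T {n : ℕ} (i j : Fin n) : (rotQ i j)ᵀ = rotQ i j := by
  simp only [rotQ, transpose_add, transpose_single, transpose_one]
  abel

lemma aux_rot {n : ℕ} {i j : Fin n} (h : i ≠ j) :
    rotQ i j ∈ Matrix.orthogonalGroup (Fin n) ℝ := by
  rw [Matrix.mem_orthogonalGroup_iff, rotQ_T]
  have h2 : √2 * √2 = 2 := Real.mul_self_sqrt (by norm_num)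
  simp only [rotQ, add_mul, mul_add, one_mul, mul_one, single_mul_single_same,
    single_mul_single_of_ne _ _ _ _ h, single_mul_single_of_ne _ _ _ _ h.symm]
  ext x y
  simp only [Matrix.add_apply, single_apply, Matrix.zero_apply]
  by_cases h1 : i = x <;> by_cases h3 : j = x <;> by_cases h4 : i = y <;> by_cases h5 : j = y <;>
    simp [h1, h3, h4, h5] <;> grind

lemma rot_apply {n : ℕ} {i j : Fin n} (h : i ≠ j) (P : Matrix (Fin n) (Fin n) ℝ) (hP : Pᵀ = P) :
    (rotQ i j * P * (rotQ i j)ᵀ) i j = (P i i - P j j) / 2 := by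
  have h2 : √2 * √2 = 2 := Real.mul_self_sqrt (by norm_num)
  have h3 : P j i = P i j := congrFun (congrFun hP i) j
  rw [rotQ_T]
  simp [rotQ, add_mul, mul_add, h, h.symm, h3]
  grind

lemma tensor_form {n : ℕ} (hn : 2 ≤ n) {Ω : Type*} [MeasurableSpace Ω] (μ : Measure Ω)
    (P : Ω → Matrix (Fin n) (Fin n) ℝ) (hsymm : ∀ ω, (P ω)ᵀ = P ω)
    (hint : ∀ i j k l, Integrable (fun ω => P ω i j * P ω k l) μ)
    (hinv : ∀ Q ∈ Matrix.orthogonalGroup (Fin n) ℝ, ∀ i j k l,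
      ∫ ω, P ω i j * P ω k l ∂μ = ∫ ω, (Q * P ω * Qᵀ) i j * (Q * P ω * Qᵀ) k l ∂μ) :
    ∃ β γ : ℝ, ∀ i j k l, ∫ ω, P ω i j * P ω k l ∂μ =
      β * ((if i = j then 1 else 0) * (if k = l then 1 else 0)) +
      γ * ((if i = k then 1 else 0) * (if j = l then 1 else 0)
        + (if i = l then 1 else 0) * (if j = k then 1 else 0)) := by
  have hs : ∀ ω i j, P ω j i = P ω i j := fun ω i j => congrFun (congrFun (hsymm ω) i) j
  obtain ⟨T, hT⟩ : ∃ T : Fin n → Fin n → Fin n → Fin n → ℝ,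
    ∀ i j k l, T i j k l = ∫ ω, P ω i j * P ω k l ∂μ := ⟨_, fun _ _ _ _ => rfl⟩
  have s1 : ∀ i j k l, T i j k l = T j i k l := by
    intro i j k l; rw [hT, hT]; congr 1; ext ω; rw [hs ω i j]
  have s2 : ∀ i j k l, T i j k l = T k l i j := by
    intro i j k l; rw [hT, hT]; congr 1; ext ω; rw [mul_comm]
  have hperm : ∀ (σ : Equiv.Perm (Fin n)) i j k l, T i j k l = T (σ i) (σ j) (σ k) (σ l) := by
    intro σ i j k l
    rw [hT, hT, hinv _ (aux_perm σ)]
    have : ∀ ω, (1 : Matrix (Fin n) (Fin n) ℝ).submatrix σ id * P ω *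
        ((1 : Matrix (Fin n) (Fin n) ℝ).submatrix σ id)ᵀ = (P ω).submatrix σ σ := by
      intro ω
      ext x y
      simp [Matrix.mul_apply, Matrix.one_apply]
    simp only [this, submatrix_apply]
  have hsign : ∀ m i j k l, T i j k l = (if i = m then -1 else 1) * (if j = m then -1 else 1) *
      (if k = m then -1 else 1) * (if l = m then -1 else 1) * T i j k l := by
    intro m i j k l
    conv_lhs => rw [hT, hinv _ (aux_sign m)]
    rw [hT, ← integral_const_mul]
    congr 1; ext ω
    rw [diagonal_transpose]
    simp only [mul_diagonal, diagonal_mul]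
    ring
  have hrot : ∀ i j, i ≠ j → T i j i j = (T i i i i - T i i j j - T j j i i + T j j j j) / 4 := by
    intro i j h
    simp only [hT]
    rw [hinv _ (aux_rot h), ← integral_sub (hint _ _ _ _) (hint _ _ _ _),
      ← integral_sub _ (hint _ _ _ _), ← integral_add _ (hint _ _ _ _), ← integral_div]
    · congr 1; ext ω
      rw [rot_apply h _ (hsymm ω)]
      ring
    · exact ((hint _ _ _ _).sub (hint _ _ _ _)).sub (hint _ _ _ _)
    · exact ((hint _ _ _ _).sub (hint _ _ _ _))
  let a : Fin n := ⟨0, by omega⟩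
  let b : Fin n := ⟨1, by omega⟩
  have hab : a ≠ b := by simp [a, b]
  have htr : ∀ i j, i ≠ j → ∃ σ : Equiv.Perm (Fin n), σ a = i ∧ σ b = j := by
    intro i j h
    refine ⟨(Equiv.swap a i).trans (Equiv.swap (Equiv.swap a i b) j), ?_, ?_⟩
    · simp only [Equiv.trans_apply, Equiv.swap_apply_left]
      apply Equiv.swap_apply_of_ne_of_ne _ h
      intro h'
      have := (Equiv.swap a i).injective (h'.symm.trans (Equiv.swap_apply_left a i).symm)
      exact hab this.symm
    · simp
  have e1 : ∀ i j, i ≠ j → T i i j j = T a a b b := by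
    intro i j h; obtain ⟨σ, rfl, rfl⟩ := htr i j h; rw [← hperm σ]
  have e2 : ∀ i j, i ≠ j → T i j i j = T a b a b := by
    intro i j h; obtain ⟨σ, rfl, rfl⟩ := htr i j h; rw [← hperm σ]
  have e3 : ∀ i, T i i i i = T a a a a := by
    intro i; rw [hperm (Equiv.swap i a)]; simp
  have e4 : T a a a a = T a a b b + 2 * T a b a b := by
    have := hrot a b hab
    rw [e3 b, e1 b a hab.symm] at this
    linarith
  refine ⟨T a a b b, T a b a b, fun i j k l => ?_⟩
  rw [← hT]
  have hi := hsign i i j k l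
  have hj := hsign j i j k l
  have hk := hsign k i j k l
  have hl := hsign l i j k l
  by_cases h1 : i = j
  · subst h1
    by_cases h2 : k = l
    · subst h2
      by_cases h3 : i = k
      · subst h3; simp [e3, e4]; ring
      · simp [h3, e1 i k h3]
    · grind
  · by_cases h2 : i = k
    · subst h2
      by_cases h3 : j = l
      · subst h3; simp [h1, e2 i j h1]
      · simp only [h1, h3, if_false]; grind
    · by_cases h3 : i = l
      · subst h3
        by_cases h4 : j = k
        · subst h4; rw [s1, e2 j i (Ne.symm h1)]; simp [h1, Ne.symm h1]
        · grind
      · grind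

lemma haar_inv {n k : ℕ} (hk : k ≤ n)
    [MeasurableSpace (Matrix.orthogonalGroup (Fin n) ℝ)]
    [BorelSpace (Matrix.orthogonalGroup (Fin n) ℝ)]
    (μ : Measure (Matrix.orthogonalGroup (Fin n) ℝ))
    [μ.IsHaarMeasure] (f : Matrix (Fin n) (Fin k) ℝ → ℝ) (Q : Matrix.orthogonalGroup (Fin n) ℝ) :
    ∫ H, f ((H : Matrix (Fin n) (Fin n) ℝ).submatrix id (Fin.castLE hk)) ∂μ =
    ∫ H, f (Q.1 * (H : Matrix (Fin n) (Fin n) ℝ).submatrix id (Fin.castLE hk)) ∂μ := by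
  rw [← integral_mul_left_eq_self _ Q]
  rfl

lemma haar_int {n k : ℕ} (hk : k ≤ n)
    [MeasurableSpace (Matrix.orthogonalGroup (Fin n) ℝ)]
    [BorelSpace (Matrix.orthogonalGroup (Fin n) ℝ)]
    (μ : Measure (Matrix.orthogonalGroup (Fin n) ℝ))
    [IsProbabilityMeasure μ] (f : Matrix (Fin n) (Fin n) ℝ → ℝ) (hf : Continuous f)  :
    Integrable (fun H : Matrix.orthogonalGroup (Fin n) ℝ => f H.1) μ := by
  have hc : IsCompact (Set.pi Set.univ (fun _ : Fin n => Set.pi Set.univ (fun _ : Fin n => Set.Icc (-1:ℝ) 1))) :=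
    isCompact_univ_pi fun _ => isCompact_univ_pi fun _ => isCompact_Icc
  obtain ⟨C, hC⟩ := hc.exists_bound_of_continuousOn (f := f) hf.continuousOn
  have hm : Continuous (fun H : Matrix.orthogonalGroup (Fin n) ℝ => f H.1) :=
    hf.comp continuous_subtype_val
  refine Integrable.of_bound hm.measurable.aestronglyMeasurable C (.of_forall fun H => hC _ ?_)
  intro i _ j _
  have := entry_norm_bound_of_unitary H.2 i j
  rw [Real.norm_eq_abs, abs_le] at this
  exact this

lemma sum_aux {n : ℕ} (A B : Matrix (Fin n) (Fin n) ℝ) (hA : ∀ i j, A j i = A i j) (β γ : ℝ) :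
    ∑ x : Fin n × Fin n, ∑ y : Fin n × Fin n, A x.1 x.2 * B y.1 y.2 *
      (β * ((if x.2 = x.1 then 1 else 0) * (if y.2 = y.1 then 1 else 0)) +
      γ * ((if x.2 = y.2 then 1 else 0) * (if x.1 = y.1 then 1 else 0)
        + (if x.2 = y.1 then 1 else 0) * (if x.1 = y.2 then 1 else 0)))
    = β * (trace A * trace B) + 2 * γ * trace (A * B) := by
  have h : ∀ x : Fin n × Fin n, ∑ y : Fin n × Fin n, A x.1 x.2 * B y.1 y.2 *
      (β * ((if x.2 = x.1 then 1 else 0) * (if y.2 = y.1 then 1 else 0)) +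
      γ * ((if x.2 = y.2 then 1 else 0) * (if x.1 = y.1 then 1 else 0)
        + (if x.2 = y.1 then 1 else 0) * (if x.1 = y.2 then 1 else 0)))
      = β * trace B * (if x.2 = x.1 then A x.1 x.2 else 0) + γ * (A x.1 x.2 * B x.1 x.2)
        + γ * (A x.1 x.2 * B x.2 x.1) := by
    intro x
    simp only [Fintype.sum_prod_type, mul_add, Finset.sum_add_distrib, ← add_assoc]
    congr 1
    · congr 1
      · by_cases hx : x.2 = x.1
        · simp [hx, trace, Finset.mul_sum, Finset.sum_mul]
          exact Finset.sum_congr rfl fun _ _ => by ring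
        · simp [hx]
      · simp; ring
    · simp; ring
  rw [Finset.sum_congr rfl fun x _ => h x]
  simp only [Fintype.sum_prod_type, Finset.sum_add_distrib, ← Finset.mul_sum]
  have t2 : ∑ i, ∑ j, A i j * B j i = trace (A * B) := by
    simp [trace, Matrix.mul_apply]
  have t3 : ∑ i, ∑ j, A i j * B i j = trace (A * B) := by
    rw [← t2, Finset.sum_comm]
    simp only [hA]
  rw [t2, t3]
  simp [trace]
  ring

lemma sum_aux2 {n : ℕ} (β γ : ℝ) : β * n + γ * (n + n^2) = ∑ i : Fin n, ∑ j : Fin n,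
      (β * ((if i = j then 1 else 0) * (if j = i then 1 else 0)) +
      γ * ((if i = j then 1 else 0) * (if j = i then 1 else 0)
        + (if i = i then 1 else 0) * (if j = j then 1 else 0))) := by
  simp [mul_add, Finset.sum_add_distrib]
  ring

/-- For `H` Haar-distributed on `O(n)`, `Z` the first `k ≤ n` columns of `H`, and `A`, `B`
fixed symmetric matrices:
`E(tr(ZᵀAZ)·tr(ZᵀBZ)) = (k(nk+k-2)·tr(A)·tr(B) + 2k(n-k)·tr(AB)) / (n(n-1)(n+2))`. -/
theorem haar_expect_trace_ZAZ_mul_trace_ZBZ {n k : ℕ} (hn : 2 ≤ n) (hk : k ≤ n)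
    [MeasurableSpace (Matrix.orthogonalGroup (Fin n) ℝ)]
    [BorelSpace (Matrix.orthogonalGroup (Fin n) ℝ)]
    (μ : Measure (Matrix.orthogonalGroup (Fin n) ℝ))
    [μ.IsHaarMeasure] [IsProbabilityMeasure μ]
    (A B : Matrix (Fin n) (Fin n) ℝ) (hA : A.IsSymm) (hB : B.IsSymm) :
    ∫ H, Matrix.trace
          (((H : Matrix (Fin n) (Fin n) ℝ).submatrix id (Fin.castLE hk))ᵀ * A *
            ((H : Matrix (Fin n) (Fin n) ℝ).submatrix id (Fin.castLE hk))) *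
        Matrix.trace
          (((H : Matrix (Fin n) (Fin n) ℝ).submatrix id (Fin.castLE hk))ᵀ * B *
            ((H : Matrix (Fin n) (Fin n) ℝ).submatrix id (Fin.castLE hk))) ∂μ
      = ((k : ℝ) * ((n : ℝ) * k + k - 2) * Matrix.trace A * Matrix.trace B
          + 2 * (k : ℝ) * ((n : ℝ) - k) * Matrix.trace (A * B))
        / ((n : ℝ) * ((n : ℝ) - 1) * ((n : ℝ) + 2)) := by
  let Z : Matrix.orthogonalGroup (Fin n) ℝ → Matrix (Fin n) (Fin k) ℝ :=
    fun H => (H : Matrix (Fin n) (Fin n) ℝ).submatrix id (Fin.castLE hk)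
  let P : Matrix.orthogonalGroup (Fin n) ℝ → Matrix (Fin n) (Fin n) ℝ := fun H => Z H * (Z H)ᵀ
  have hZ : ∀ H, (Z H)ᵀ * Z H = 1 := by
    intro H
    have h := (Matrix.mem_orthogonalGroup_iff' (Fin n) ℝ).1 H.2
    simp only [Z, transpose_submatrix]
    rw [← submatrix_mul _ _ _ _ _ Function.bijective_id, h,
      submatrix_one _ (Fin.castLE_injective hk)]
  have hint : ∀ i j k l, Integrable (fun ω => P ω i j * P ω k l) μ := by
    intro i j p q
    refine haar_int hk μ (fun M => (M.submatrix id (Fin.castLE hk) *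
      (M.submatrix id (Fin.castLE hk))ᵀ) i j * (M.submatrix id (Fin.castLE hk) *
      (M.submatrix id (Fin.castLE hk))ᵀ) p q) ?_
    simp only [Matrix.mul_apply, transpose_apply, submatrix_apply, id]
    fun_prop
  obtain ⟨β, γ, hT⟩ := tensor_form hn μ P (fun ω => by simp [P]) hint (by
    intro Q hQ i j p q
    refine (haar_inv hk μ (fun M => (M * Mᵀ) i j * (M * Mᵀ) p q) ⟨Q, hQ⟩).trans ?_
    simp only [P, Z, transpose_mul, Matrix.mul_assoc])
  have hmain : ∀ A B : Matrix (Fin n) (Fin n) ℝ, A.IsSymm → 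
      ∫ H, trace ((Z H)ᵀ * A * Z H) * trace ((Z H)ᵀ * B * Z H) ∂μ
        = β * (trace A * trace B) + 2 * γ * trace (A * B) := by
    intro A B hA
    have ht : ∀ (A : Matrix (Fin n) (Fin n) ℝ) H, trace ((Z H)ᵀ * A * Z H) = ∑ x : Fin n × Fin n, A x.1 x.2 * P H x.2 x.1 := by
      intro A H
      rw [Matrix.mul_assoc, trace_mul_comm, Matrix.mul_assoc, Fintype.sum_prod_type]
      simp only [trace, diag, Matrix.mul_apply (M := A), P]
    have hA' : ∀ i j, A j i = A i j := fun i j => hA.apply i j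
    simp only [ht, Finset.sum_mul_sum]
    have hr : ∀ (x y : Fin n × Fin n) H, A x.1 x.2 * P H x.2 x.1 * (B y.1 y.2 * P H y.2 y.1)
      = A x.1 x.2 * B y.1 y.2 * (P H x.2 x.1 * P H y.2 y.1) := by intros; ring
    simp only [hr]
    rw [integral_finsetSum _ (fun x _ => integrable_finsetSum _ fun y _ => (hint _ _ _ _).const_mul _)]
    have : ∀ x : Fin n × Fin n, ∫ H, ∑ y : Fin n × Fin n, A x.1 x.2 * B y.1 y.2 * (P H x.2 x.1 * P H y.2 y.1) ∂μ
       = ∑ y : Fin n × Fin n, A x.1 x.2 * B y.1 y.2 * ∫ H, (P H x.2 x.1 * P H y.2 y.1) ∂μ := by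
      intro x
      rw [integral_finsetSum _ (fun y _ => (hint _ _ _ _).const_mul _)]
      simp only [integral_const_mul]
    rw [Finset.sum_congr rfl fun x _ => this x]
    simp only [hT]
    exact sum_aux A B hA' β γ
  have q1 : β * n ^ 2 + 2 * γ * n = k ^ 2 := by
    have := hmain 1 1 (by simp [Matrix.IsSymm])
    simp [hZ] at this
    linarith
  have q2 : β * n + γ * (n + n^2) = k := by
    have h1 : ∀ H, ∑ i, ∑ j, P H i j * P H j i = k := by
      intro H
      have : trace (P H * P H) = k := by
        simp only [P]
        rw [Matrix.mul_assoc, trace_mul_comm, Matrix.mul_assoc, Matrix.mul_assoc, hZ, Matrix.mul_one, hZ]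
        simp
      simpa [trace, Matrix.mul_apply] using this
    have h2 : ∫ H, ∑ i, ∑ j, P H i j * P H j i ∂μ = k := by simp [h1]
    rw [integral_finsetSum _ (fun x _ => integrable_finsetSum _ fun y _ => (hint _ _ _ _))] at h2
    simp only [integral_finsetSum _ (fun y _ => (hint _ y y _)), hT] at h2
    rw [← h2]
    simpa only [eq_self_iff_true] using sum_aux2 (n := n) β γ
  have hn' : (2:ℝ) ≤ n := by exact_mod_cast hn
  have d1 : (n:ℝ) - 1 ≠ 0 := by linarith
  refine (hmain A B hA).trans ?_
  have hβ : β = (k : ℝ) * ((n : ℝ) * k + k - 2) / ((n : ℝ) * ((n : ℝ) - 1) * ((n : ℝ) + 2)) := by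
    rw [eq_div_iff (by positivity)]
    linear_combination (n+1) * q1 - 2 * q2
  have hγ : γ = (k : ℝ) * (n - k) / ((n : ℝ) * ((n : ℝ) - 1) * ((n : ℝ) + 2)) := by
    rw [eq_div_iff (by positivity)]
    linear_combination n * q2 - q1
  rw [hβ, hγ]
  field_simp
end

section
/- Let H be Haar-distributed on O(n), n ≥ 2, and Z the first k ≤ n columns of H. For fixed n×n symmetric matrices A and B, cov(tr(Z'AZ), tr(Z'BZ)) = 2k(n-k)·(tr(AB) - tr(A)·tr(B)/n) / (n(n-1)(n+2)). In particular, this covariance vanishes when k = n. -/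
open Matrix MeasureTheory

namespace HaarCov

variable {n k : ℕ}

/-- the projection onto the first k columns -/
noncomputable def P (hk : k ≤ n) (H : Matrix (Fin n) (Fin n) ℝ) : Matrix (Fin n) (Fin n) ℝ :=
  H.submatrix id (Fin.castLE hk) * (H.submatrix id (Fin.castLE hk))ᵀ

lemma P_symm (hk : k ≤ n) (H : Matrix (Fin n) (Fin n) ℝ) : (P hk H)ᵀ = P hk H := by
  simp [P]

lemma P_symm' (hk : k ≤ n) (H : Matrix (Fin n) (Fin n) ℝ) (i j) : P hk H j i = P hk H i j := by
  conv_lhs => rw [← P_symm hk H]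
  rfl

lemma P_mul (hk : k ≤ n) (U H : Matrix (Fin n) (Fin n) ℝ) : P hk (U * H) = U * P hk H * Uᵀ := by
  have : (U * H).submatrix id (Fin.castLE hk) = U * H.submatrix id (Fin.castLE hk) := by
    ext i j; simp [Matrix.mul_apply]
  simp [P, this, Matrix.mul_assoc]

lemma Z_orth (hk : k ≤ n) (H : Matrix.orthogonalGroup (Fin n) ℝ) :
    ((H : Matrix (Fin n) (Fin n) ℝ).submatrix id (Fin.castLE hk))ᵀ *
      ((H : Matrix (Fin n) (Fin n) ℝ).submatrix id (Fin.castLE hk)) = 1 := by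
  have h : (H : Matrix (Fin n) (Fin n) ℝ)ᵀ * H = 1 := by
    have := H.2
    rw [Matrix.mem_orthogonalGroup_iff'] at this
    simpa [Matrix.star_eq_conjTranspose] using this
  ext i j
  have := congrFun (congrFun h (Fin.castLE hk i)) (Fin.castLE hk j)
  simp only [Matrix.mul_apply, Matrix.transpose_apply, Matrix.submatrix_apply, id] at this ⊢
  rw [this]
  simp [Matrix.one_apply]

lemma P_trace (hk : k ≤ n) (H : Matrix.orthogonalGroup (Fin n) ℝ) :
    trace (P hk (H : Matrix (Fin n) (Fin n) ℝ)) = k := by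
  rw [P, Matrix.trace_mul_comm, Z_orth]; simp

lemma P_sq (hk : k ≤ n) (H : Matrix.orthogonalGroup (Fin n) ℝ) :
    P hk (H : Matrix (Fin n) (Fin n) ℝ) * P hk H = P hk H := by
  rw [P, Matrix.mul_assoc, ← Matrix.mul_assoc _ᵀ, Z_orth, Matrix.one_mul]

lemma P_sumsq (hk : k ≤ n) (H : Matrix.orthogonalGroup (Fin n) ℝ) :
    ∑ i, ∑ j, P hk (H : Matrix (Fin n) (Fin n) ℝ) i j * P hk H i j = k := by
  rw [← P_trace hk H]
  conv_rhs => rw [← P_sq]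
  simp only [trace, Matrix.diag, Matrix.mul_apply]
  refine Finset.sum_congr rfl fun i _ => Finset.sum_congr rfl fun j _ => ?_
  rw [P_symm' hk _ i j]

lemma P_le (hk : k ≤ n) (H : Matrix.orthogonalGroup (Fin n) ℝ) (i j : Fin n) :
    |P hk (H : Matrix (Fin n) (Fin n) ℝ) i j| ≤ k + 1 := by
  have h := P_sumsq hk H
  have h1 : P hk (H : Matrix (Fin n) (Fin n) ℝ) i j * P hk H i j ≤ k := by
    rw [← h]
    refine le_trans ?_ (Finset.single_le_sum (f := fun i => ∑ j, P hk (H : Matrix (Fin n) (Fin n) ℝ) i j * P hk H i j) (fun i _ => Finset.sum_nonneg fun j _ => mul_self_nonneg _) (Finset.mem_univ i))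
    exact (Finset.single_le_sum (f := fun j => P hk (H : Matrix (Fin n) (Fin n) ℝ) i j * P hk H i j) (fun j _ => mul_self_nonneg _) (Finset.mem_univ j))
  have h0 : (0:ℝ) ≤ k := Nat.cast_nonneg k
  refine abs_le_of_sq_le_sq ?_ (by positivity)
  nlinarith

lemma P_cont (hk : k ≤ n) (i j : Fin n) :
    Continuous fun H : Matrix.orthogonalGroup (Fin n) ℝ => P hk (H : Matrix (Fin n) (Fin n) ℝ) i j := by
  unfold P
  have : Continuous fun H : Matrix.orthogonalGroup (Fin n) ℝ => (H : Matrix (Fin n) (Fin n) ℝ) :=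
    continuous_subtype_val
  exact ((this.matrix_submatrix _ _).matrix_mul (this.matrix_submatrix _ _).matrix_transpose).matrix_elem i j

lemma tr_eq (hk : k ≤ n) (A H : Matrix (Fin n) (Fin n) ℝ) :
    trace ((H.submatrix id (Fin.castLE hk))ᵀ * A * H.submatrix id (Fin.castLE hk))
      = trace (A * P hk H) := by
  rw [Matrix.mul_assoc, Matrix.trace_mul_comm, P, Matrix.mul_assoc]

variable [MeasurableSpace (Matrix.orthogonalGroup (Fin n) ℝ)]
    [BorelSpace (Matrix.orthogonalGroup (Fin n) ℝ)]
    (μ : Measure (Matrix.orthogonalGroup (Fin n) ℝ))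
    [μ.IsHaarMeasure] [IsProbabilityMeasure μ]

lemma inv (hk : k ≤ n) (φ : Matrix (Fin n) (Fin n) ℝ → ℝ) (U : Matrix.orthogonalGroup (Fin n) ℝ) :
    ∫ H, φ (P hk (H : Matrix (Fin n) (Fin n) ℝ)) ∂μ
      = ∫ H, φ ((U : Matrix (Fin n) (Fin n) ℝ) * P hk (H : Matrix (Fin n) (Fin n) ℝ)
        * (U : Matrix (Fin n) (Fin n) ℝ)ᵀ) ∂μ := by
  rw [← integral_mul_left_eq_self _ U]
  simp [P_mul]

lemma PP_int (hk : k ≤ n) (i j l m : Fin n) :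
    Integrable (fun H : Matrix.orthogonalGroup (Fin n) ℝ =>
      P hk (H : Matrix (Fin n) (Fin n) ℝ) i j * P hk (H : Matrix (Fin n) (Fin n) ℝ) l m) μ := by
  apply Integrable.of_bound (C := (k+1)*(k+1))
  · exact ((P_cont hk i j).mul (P_cont hk l m)).measurable.aestronglyMeasurable
  · refine Filter.Eventually.of_forall fun H => ?_
    rw [norm_mul]
    exact mul_le_mul (P_le hk H i j) (P_le hk H l m) (norm_nonneg _) (by positivity)

/-- fourth moments -/
noncomputable def T (hk : k ≤ n) (i j l m : Fin n) : ℝ :=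
  ∫ H, P hk (H : Matrix (Fin n) (Fin n) ℝ) i j * P hk (H : Matrix (Fin n) (Fin n) ℝ) l m ∂μ

/-- the bilinear form -/
noncomputable def F (hk : k ≤ n) (A B : Matrix (Fin n) (Fin n) ℝ) : ℝ :=
  ∫ H, trace (A * P hk (H : Matrix (Fin n) (Fin n) ℝ)) *
    trace (B * P hk (H : Matrix (Fin n) (Fin n) ℝ)) ∂μ

lemma F_eq (hk : k ≤ n) (A B : Matrix (Fin n) (Fin n) ℝ) :
    F μ hk A B = ∑ i, ∑ j, ∑ l, ∑ m, A i j * B l m * T μ hk i j l m := by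
  have : ∀ H : Matrix.orthogonalGroup (Fin n) ℝ, trace (A * P hk (H : Matrix (Fin n) (Fin n) ℝ)) *
    trace (B * P hk (H : Matrix (Fin n) (Fin n) ℝ)) = ∑ i, ∑ j, ∑ l, ∑ m, A i j * B l m *
      (P hk (H : Matrix (Fin n) (Fin n) ℝ) i j * P hk (H : Matrix (Fin n) (Fin n) ℝ) l m) := by
    intro H
    simp only [trace, Matrix.diag, Matrix.mul_apply, Finset.sum_mul]
    refine Finset.sum_congr rfl fun i _ => Finset.sum_congr rfl fun j _ => ?_
    simp only [Finset.mul_sum]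
    refine Finset.sum_congr rfl fun l _ => Finset.sum_congr rfl fun m _ => ?_
    rw [P_symm' hk _ i j, P_symm' hk _ l m]
    ring
  have hi := PP_int μ hk
  simp only [F, this, T]
  rw [integral_finsetSum _ fun i _ => integrable_finsetSum _ fun j _ => integrable_finsetSum _ fun l _ => integrable_finsetSum _ fun m _ => (hi i j l m).const_mul _]
  refine Finset.sum_congr rfl fun i _ => ?_
  rw [integral_finsetSum _ fun j _ => integrable_finsetSum _ fun l _ => integrable_finsetSum _ fun m _ => (hi i j l m).const_mul _]
  refine Finset.sum_congr rfl fun j _ => ?_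
  rw [integral_finsetSum _ fun l _ => integrable_finsetSum _ fun m _ => (hi i j l m).const_mul _]
  refine Finset.sum_congr rfl fun l _ => ?_
  rw [integral_finsetSum _ fun m _ => (hi i j l m).const_mul _]
  refine Finset.sum_congr rfl fun m _ => ?_
  rw [integral_const_mul]

lemma F_inv (hk : k ≤ n) (A B : Matrix (Fin n) (Fin n) ℝ) (U : Matrix.orthogonalGroup (Fin n) ℝ) :
    F μ hk A B = F μ hk ((U : Matrix (Fin n) (Fin n) ℝ)ᵀ * A * U)
      ((U : Matrix (Fin n) (Fin n) ℝ)ᵀ * B * U) := by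
  have h : ∀ A Q : Matrix (Fin n) (Fin n) ℝ, trace (A * ((U : Matrix (Fin n) (Fin n) ℝ) * Q * (U : Matrix (Fin n) (Fin n) ℝ)ᵀ)) = trace ((U : Matrix (Fin n) (Fin n) ℝ)ᵀ * A * (U : Matrix (Fin n) (Fin n) ℝ) * Q) := by
    intro A Q
    rw [← Matrix.mul_assoc, Matrix.trace_mul_comm]
    simp only [Matrix.mul_assoc]
  unfold F
  rw [inv μ hk (fun Q => trace (A * Q) * trace (B * Q)) U]
  simp only [h]

lemma T_perm (hk : k ≤ n) (σ : Equiv.Perm (Fin n)) (i j l m : Fin n) :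
    T μ hk i j l m = T μ hk (σ i) (σ j) (σ l) (σ m) := by
  have hU : (σ.permMatrix ℝ) ∈ Matrix.orthogonalGroup (Fin n) ℝ := by
    rw [Matrix.mem_orthogonalGroup_iff, Matrix.transpose_permMatrix,
      ← Matrix.permMatrix_mul]
    simp
  unfold T
  rw [inv μ hk (fun Q => Q i j * Q l m) ⟨_, hU⟩]
  have : ∀ (Q : Matrix (Fin n) (Fin n) ℝ) i j, (σ.permMatrix ℝ * Q * (σ.permMatrix ℝ)ᵀ) i j = Q (σ i) (σ j) := by
    intro Q i j
    simp [Matrix.mul_apply, Equiv.Perm.permMatrix, PEquiv.toMatrix_apply, Equiv.toPEquiv_apply, Equiv.symm_apply_eq]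
  simp only [this]

lemma T_sign (hk : k ≤ n) (i j l : Fin n) (h : j ≠ l) : T μ hk i i j l = 0 := by
  let d : Fin n → ℝ := fun x => if x = j then -1 else 1
  have hd : ∀ x, d x * d x = 1 := by intro x; simp only [d]; split_ifs <;> norm_num
  have hU : diagonal d ∈ Matrix.orthogonalGroup (Fin n) ℝ := by
    rw [Matrix.mem_orthogonalGroup_iff, Matrix.diagonal_transpose,
      Matrix.diagonal_mul_diagonal]
    simp [hd]
  have h1 : T μ hk i i j l = - T μ hk i i j l := by
    conv_lhs => unfold T
    rw [inv μ hk (fun Q => Q i i * Q j l) ⟨_, hU⟩, T, ← integral_neg]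
    congr 1
    ext H
    simp only [Matrix.diagonal_transpose, Matrix.mul_diagonal, Matrix.diagonal_mul]
    have e1 : d j = -1 := by simp [d]
    have e2 : d l = 1 := by simp [d, h.symm]
    rw [e1, e2]
    linear_combination (P hk (H : Matrix (Fin n) (Fin n) ℝ) i i * -P hk (H : Matrix (Fin n) (Fin n) ℝ) j l) * hd i
  linarith

lemma F_form (hn : 2 ≤ n) (hk : k ≤ n) : ∃ r q : ℝ, (∀ A B : Matrix (Fin n) (Fin n) ℝ, A.IsSymm →
    F μ hk A B = r * trace (A * B) + q * (trace A * trace B)) ∧ ∀ i, T μ hk i i i i = r + q := by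
  let a : Fin n := ⟨0, by omega⟩
  let b : Fin n := ⟨1, by omega⟩
  have hab : a ≠ b := by simp [a, b]
  have h1 : ∀ i, T μ hk i i i i = T μ hk a a a a := by
    intro i
    rw [T_perm μ hk (Equiv.swap i a)]; simp
  have h2 : ∀ i j, i ≠ j → T μ hk i i j j = T μ hk a a b b := by
    intro i j hij
    obtain ⟨σ, h1, h2⟩ := (MulAction.is_two_pretransitive_iff (G := Equiv.Perm (Fin n))).1
      (Equiv.Perm.isMultiplyPretransitive (Fin n) 2) hij hab
    rw [T_perm μ hk σ]
    simp only [Equiv.Perm.smul_def] at h1 h2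
    rw [h1, h2]
  have hd : ∀ (d : Fin n → ℝ) (B : Matrix (Fin n) (Fin n) ℝ), F μ hk (diagonal d) B =
      (T μ hk a a a a - T μ hk a a b b) * trace (diagonal d * B) +
        T μ hk a a b b * (trace (diagonal d) * trace B) := by
    intro d B
    rw [F_eq]
    have e : ∀ i, ∑ j, ∑ l, ∑ m, diagonal d i j * B l m * T μ hk i j l m
        = ∑ l, d i * B l l * T μ hk i i l l := by
      intro i
      rw [Finset.sum_eq_single i (by intro j _ hj; simp [Matrix.diagonal_apply_ne' _ hj]) (by simp)]
      refine Finset.sum_congr rfl fun l _ => ?_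
      rw [Finset.sum_eq_single l (by intro m _ hm; simp [T_sign μ hk i l m hm.symm]) (by simp)]
      simp
    have e2 : ∀ i l, T μ hk i i l l = T μ hk a a b b + if i = l then (T μ hk a a a a - T μ hk a a b b) else 0 := by
      intro i l
      split_ifs with h
      · subst h; rw [h1]; ring
      · rw [h2 i l h]; ring
    simp only [e]
    generalize T μ hk a a b b = q at e2 ⊢
    generalize T μ hk a a a a = p at e2 ⊢
    simp only [e2, mul_add, Finset.sum_add_distrib]
    simp only [trace, Matrix.diag, Matrix.diagonal_mul, Matrix.diagonal_apply_eq, mul_ite, mul_zero, Finset.sum_ite_eq, Finset.mem_univ, if_true]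
    rw [Finset.sum_mul_sum, Finset.mul_sum, Finset.mul_sum, add_comm]
    simp only [Finset.mul_sum]
    congr 1
    · exact Finset.sum_congr rfl fun i _ => by ring
    · exact Finset.sum_congr rfl fun i _ => Finset.sum_congr rfl fun j _ => by ring
  refine ⟨T μ hk a a a a - T μ hk a a b b, T μ hk a a b b, ?_, fun i => by rw [h1]; ring⟩
  intro A B hA
  have hA' : A.IsHermitian := by
    rw [Matrix.IsHermitian, Matrix.conjTranspose_eq_transpose_of_trivial]; exact hA
  obtain ⟨U, d, hUd⟩ : ∃ (U : Matrix.orthogonalGroup (Fin n) ℝ) (d : Fin n → ℝ),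
      A = (U : Matrix (Fin n) (Fin n) ℝ) * diagonal d * (U : Matrix (Fin n) (Fin n) ℝ)ᵀ := by
    refine ⟨hA'.eigenvectorUnitary, hA'.eigenvalues, ?_⟩
    have := hA'.spectral_theorem
    rw [Unitary.conjStarAlgAut_apply] at this
    rw [Matrix.star_eq_conjTranspose, Matrix.conjTranspose_eq_transpose_of_trivial] at this
    exact this
  have hU1 : (U : Matrix (Fin n) (Fin n) ℝ)ᵀ * U = 1 := by
    have := U.2
    rw [Matrix.mem_orthogonalGroup_iff'] at this
    simpa [Matrix.star_eq_conjTranspose] using this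
  have hU2 : (U : Matrix (Fin n) (Fin n) ℝ) * (U : Matrix (Fin n) (Fin n) ℝ)ᵀ = 1 := by
    have := U.2
    rw [Matrix.mem_orthogonalGroup_iff] at this
    simpa [Matrix.star_eq_conjTranspose] using this
  have h3 : (U : Matrix (Fin n) (Fin n) ℝ)ᵀ * A * U = diagonal d := by
    rw [hUd]
    calc _ = ((U : Matrix (Fin n) (Fin n) ℝ)ᵀ * U) * diagonal d * ((U : Matrix (Fin n) (Fin n) ℝ)ᵀ * U) := by
          simp only [Matrix.mul_assoc]
      _ = _ := by rw [hU1]; simp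
  have ht : ∀ C : Matrix (Fin n) (Fin n) ℝ, trace ((U : Matrix (Fin n) (Fin n) ℝ)ᵀ * C * (U : Matrix (Fin n) (Fin n) ℝ)) = trace C := by
    intro C
    rw [Matrix.trace_mul_comm, ← Matrix.mul_assoc, hU2, Matrix.one_mul]
  rw [F_inv μ hk A B U, h3, hd, ht, ← h3, ht, ← ht (A * B)]
  congr 3
  calc _ = (U : Matrix (Fin n) (Fin n) ℝ)ᵀ * A * (U * (U : Matrix (Fin n) (Fin n) ℝ)ᵀ) * B * U := by
        simp only [Matrix.mul_assoc]
    _ = _ := by rw [hU2]; simp [Matrix.mul_assoc]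

lemma T_off (hk : k ≤ n) (r q : ℝ) (h : ∀ A B : Matrix (Fin n) (Fin n) ℝ, A.IsSymm →
    F μ hk A B = r * trace (A * B) + q * (trace A * trace B)) (i j : Fin n) (hij : i ≠ j) :
    T μ hk i j i j = r / 2 := by
  have h1 := h (Matrix.single i j 1 + Matrix.single j i 1) (Matrix.single i j 1 + Matrix.single j i 1)
    (by simp [Matrix.IsSymm, add_comm])
  have h2 : F μ hk (Matrix.single i j 1 + Matrix.single j i 1) (Matrix.single i j 1 + Matrix.single j i 1) = 4 * T μ hk i j i j := by
    rw [F, T, ← integral_const_mul]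
    congr 1
    ext H
    have : trace ((Matrix.single i j 1 + Matrix.single j i 1) * P hk (H : Matrix (Fin n) (Fin n) ℝ)) = 2 * P hk (H : Matrix (Fin n) (Fin n) ℝ) i j := by
      rw [Matrix.add_mul, Matrix.trace_add, Matrix.trace_single_mul, Matrix.trace_single_mul]
      rw [P_symm' hk _ i j]; simp; ring
    rw [this]; ring
  rw [h2] at h1
  have h3 : trace ((Matrix.single i j (1:ℝ) + Matrix.single j i 1) * (Matrix.single i j 1 + Matrix.single j i 1)) = 2 := by
    simp [Matrix.mul_add, Matrix.add_mul, Matrix.trace_add, hij, hij.symm, Matrix.trace_single_mul]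
    norm_num
  have h4 : trace (Matrix.single i j (1:ℝ) + Matrix.single j i 1) = 0 := by
    simp [hij, hij.symm]
  rw [h3, h4] at h1
  linarith

lemma T_sum (hk : k ≤ n) : ∑ i, ∑ j, T μ hk i j i j = k := by
  unfold T
  have hi := PP_int μ hk
  have : ∀ i, ∑ j, ∫ H, P hk (H : Matrix (Fin n) (Fin n) ℝ) i j * P hk (H : Matrix (Fin n) (Fin n) ℝ) i j ∂μ
     = ∫ H, ∑ j, P hk (H : Matrix (Fin n) (Fin n) ℝ) i j * P hk (H : Matrix (Fin n) (Fin n) ℝ) i j ∂μ := by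
    intro i
    rw [integral_finsetSum _ fun j _ => hi i j i j]
  simp only [this]
  rw [← integral_finsetSum _ fun i _ => integrable_finsetSum _ fun j _ => hi i j i j]
  simp [P_sumsq]

end HaarCov

/-- For `H` Haar-distributed on `O(n)`, `Z` the first `k ≤ n` columns of `H`, and `A`, `B`
fixed symmetric matrices:
`cov(tr(ZᵀAZ), tr(ZᵀBZ)) = 2k(n-k)·(tr(AB) - tr(A)tr(B)/n) / (n(n-1)(n+2))`,
where `cov(X,Y) = E(XY) - E(X)E(Y)`; in particular it vanishes when `k = n`. -/
theorem haar_cov_trace_ZAZ_trace_ZBZ {n k : ℕ} (hn : 2 ≤ n) (hk : k ≤ n)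
    [MeasurableSpace (Matrix.orthogonalGroup (Fin n) ℝ)]
    [BorelSpace (Matrix.orthogonalGroup (Fin n) ℝ)]
    (μ : Measure (Matrix.orthogonalGroup (Fin n) ℝ))
    [μ.IsHaarMeasure] [IsProbabilityMeasure μ]
    (A B : Matrix (Fin n) (Fin n) ℝ) (hA : A.IsSymm) (hB : B.IsSymm) :
    (∫ H, Matrix.trace
          (((H : Matrix (Fin n) (Fin n) ℝ).submatrix id (Fin.castLE hk))ᵀ * A *
            ((H : Matrix (Fin n) (Fin n) ℝ).submatrix id (Fin.castLE hk))) *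
        Matrix.trace
          (((H : Matrix (Fin n) (Fin n) ℝ).submatrix id (Fin.castLE hk))ᵀ * B *
            ((H : Matrix (Fin n) (Fin n) ℝ).submatrix id (Fin.castLE hk))) ∂μ)
      - (∫ H, Matrix.trace
          (((H : Matrix (Fin n) (Fin n) ℝ).submatrix id (Fin.castLE hk))ᵀ * A *
            ((H : Matrix (Fin n) (Fin n) ℝ).submatrix id (Fin.castLE hk))) ∂μ)
        * (∫ H, Matrix.trace
          (((H : Matrix (Fin n) (Fin n) ℝ).submatrix id (Fin.castLE hk))ᵀ * B *
            ((H : Matrix (Fin n) (Fin n) ℝ).submatrix id (Fin.castLE hk))) ∂μ)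
      = 2 * (k : ℝ) * ((n : ℝ) - k)
          * (Matrix.trace (A * B) - Matrix.trace A * Matrix.trace B / n)
        / ((n : ℝ) * ((n : ℝ) - 1) * ((n : ℝ) + 2)) := by 
  classical
  simp only [HaarCov.tr_eq]
  obtain ⟨r, q, hF, hT⟩ := HaarCov.F_form μ hn hk
  have hoff := HaarCov.T_off μ hk r q hF
  have hsum := HaarCov.T_sum μ hk
  have hn0 : (2:ℝ) ≤ n := by exact_mod_cast hn
  have e1 : ∀ i j, HaarCov.T μ hk i j i j = r / 2 + if i = j then r / 2 + q else 0 := by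
    intro i j
    split_ifs with h
    · subst h; rw [hT]; ring
    · rw [hoff i j h]; ring
  simp only [e1, Finset.sum_add_distrib, Finset.sum_ite_eq, Finset.mem_univ, if_true,
    Finset.sum_const, Finset.card_univ, Fintype.card_fin, nsmul_eq_mul] at hsum
  have hX : ∀ A : Matrix (Fin n) (Fin n) ℝ, HaarCov.F μ hk A 1 =
      (∫ H, trace (A * HaarCov.P hk (H : Matrix (Fin n) (Fin n) ℝ)) ∂μ) * k := by
    intro A
    simp only [HaarCov.F, Matrix.one_mul, HaarCov.P_trace]
    rw [integral_mul_const]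
  have h11 := hF 1 1 (by simp [Matrix.IsSymm])
  rw [hX] at h11
  simp only [Matrix.one_mul, HaarCov.P_trace, Matrix.trace_one, Fintype.card_fin,
    integral_const, probReal_univ, one_smul] at h11
  have hm : ∀ A : Matrix (Fin n) (Fin n) ℝ, A.IsSymm →
      ∫ H, trace (A * HaarCov.P hk (H : Matrix (Fin n) (Fin n) ℝ)) ∂μ = k * trace A / n := by
    intro A hA
    rcases Nat.eq_zero_or_pos k with h0 | h0
    · subst h0
      simp [HaarCov.P]
    · have hk0 : (0:ℝ) < k := by exact_mod_cast h0
      have h := hF A 1 hA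
      rw [hX] at h
      simp only [Matrix.mul_one, Matrix.trace_one, Fintype.card_fin] at h
      rw [eq_div_iff (by positivity)]
      apply mul_right_cancel₀ hk0.ne'
      linear_combination (n:ℝ) * h - trace A * h11
  have hr : r = 2 * (k : ℝ) * ((n : ℝ) - k) / ((n : ℝ) * ((n : ℝ) - 1) * ((n : ℝ) + 2)) := by
    have : (n : ℝ) - 1 ≠ 0 := by linarith
    rw [eq_div_iff (by positivity)]
    linear_combination (2 * (n:ℝ)) * hsum + 2 * h11
  have hq : q = (k^2 - r * n) / n^2 := by
    rw [eq_div_iff (by positivity)]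
    linear_combination -h11
  have hc := hF A B hA
  unfold HaarCov.F at hc
  rw [hc, hm A hA, hm B hB, mul_div_right_comm (2 * (k : ℝ) * ((n : ℝ) - k)), ← hr, hq]
  field_simp
  ring
end

section
/- The fourth-order Haar moment formula: for H Haar-distributed on O(n) with n ≥ 2, E(Hᵣⁱ Hₛʲ Hₜᵏ Hᵤˡ) = [(n+1)·(δᵣₛδₜᵤδⁱʲδᵏˡ + δᵣₜδₛᵤδⁱᵏδʲˡ + δᵣᵤδₛₜδⁱˡδʲᵏ) - (sum of the six cross terms δ_{π}δ^{π'} where partitions π of {r,s,t,u} and π' of {i,j,k,l} into pairs are distinct)] / (n(n-1)(n+2)). -/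
open Matrix MeasureTheory

/-- Kronecker delta as a real number. -/
noncomputable def kdelta {α : Type*} [DecidableEq α] (a b : α) : ℝ :=
  if a = b then 1 else 0

open Finset in
theorem isotropic_four {n : ℕ} (M : Fin n → Fin n → Fin n → Fin n → ℝ)
    (hinv : ∀ A : Matrix (Fin n) (Fin n) ℝ, A * Aᵀ = 1 → ∀ r s t u,
      M r s t u = ∑ a, A r a * ∑ b, A s b * ∑ c, A t c * ∑ d, A u d * M a b c d)
    (p q : Fin n) (hpq : p ≠ q) (r s t u : Fin n) :
    M r s t u = M p p q q * (kdelta r s * kdelta t u) + M p q p q * (kdelta r t * kdelta s u)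
      + M p q q p * (kdelta r u * kdelta s t) := by
  have hperm : ∀ (σ : Equiv.Perm (Fin n)) r s t u,
      M r s t u = M (σ r) (σ s) (σ t) (σ u) := by
    intro σ r s t u
    have := hinv (Matrix.of fun r a => if σ r = a then 1 else 0) (by
      ext x y
      simp [Matrix.mul_apply, Matrix.one_apply, eq_comm]) r s t u
    simpa using this
  have hsign : ∀ p r s t u, M r s t u = (if r = p then -1 else 1) * ((if s = p then -1 else 1) *
      ((if t = p then -1 else 1) * ((if u = p then -1 else 1) * M r s t u))) := by
    intro p r s t u
    have := hinv (Matrix.diagonal fun r => if r = p then -1 else 1) (by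
      rw [Matrix.diagonal_transpose, Matrix.diagonal_mul_diagonal, ← Matrix.diagonal_one]
      congr 1
      ext x
      split_ifs <;> simp) r s t u
    simpa [Matrix.diagonal_apply] using this
  have htrans : ∀ r s, r ≠ s → ∃ σ : Equiv.Perm (Fin n), σ r = p ∧ σ s = q := by
    intro r s hrs
    refine ⟨Equiv.swap (Equiv.swap r p s) q * Equiv.swap r p, ?_, ?_⟩
    · rw [Equiv.Perm.mul_apply, Equiv.swap_apply_left]
      apply Equiv.swap_apply_of_ne_of_ne
      · intro h
        apply hrs
        have h2 : Equiv.swap r p r = Equiv.swap r p s := by rw [Equiv.swap_apply_left]; exact h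
        exact (Equiv.swap r p).injective h2
      · exact hpq
    · rw [Equiv.Perm.mul_apply, Equiv.swap_apply_left]
  have h1 : ∀ r s, r ≠ s → M r r s s = M p p q q := by
    intro r s h
    obtain ⟨σ, h1, h2⟩ := htrans r s h
    rw [hperm σ, h1, h2]
  have h2 : ∀ r s, r ≠ s → M r s r s = M p q p q := by
    intro r s h
    obtain ⟨σ, h1, h2⟩ := htrans r s h
    rw [hperm σ, h1, h2]
  have h3 : ∀ r s, r ≠ s → M r s s r = M p q q p := by
    intro r s h
    obtain ⟨σ, h1, h2⟩ := htrans r s h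
    rw [hperm σ, h1, h2]
  have h4 : ∀ r, M r r r r = M p p p p := by
    intro r
    rw [hperm (Equiv.swap r p), Equiv.swap_apply_left]
  have h5 : M p p p p = M p p q q + M p q p q + M p q q p := by
    have key := hinv (1 - (2/5 : ℝ) • Matrix.vecMulVec (Pi.single p 1 + Pi.single q 2)
      (Pi.single p 1 + Pi.single q 2)) (by
        have hw : (Pi.single p 1 + Pi.single q 2 : Fin n → ℝ) ⬝ᵥ (Pi.single p 1 + Pi.single q 2) = 5 := by
          simp [hpq, hpq.symm]; norm_num
        generalize (Pi.single p 1 + Pi.single q 2 : Fin n → ℝ) = w at hw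
        have hvv : Matrix.vecMulVec w w * Matrix.vecMulVec w w = (5:ℝ) • Matrix.vecMulVec w w := by
          rw [Matrix.vecMulVec_mul_vecMulVec, hw]
          ext x y
          simp [Matrix.vecMulVec_apply]
          try ring
        have ht : (Matrix.vecMulVec w w)ᵀ = Matrix.vecMulVec w w := by
          rw [Matrix.transpose_vecMulVec]
        rw [Matrix.transpose_sub, Matrix.transpose_smul, ht, Matrix.transpose_one]
        simp only [sub_mul, mul_sub, Matrix.smul_mul, Matrix.mul_smul, hvv, one_mul, mul_one]
        module) p p p p
    have hrow : ∀ f : Fin n → ℝ, ∑ a, (1 - (2/5 : ℝ) • Matrix.vecMulVec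
        (Pi.single p 1 + Pi.single q 2 : Fin n → ℝ) (Pi.single p 1 + Pi.single q 2)) p a * f a
        = 3/5 * f p - 4/5 * f q := by
      intro f
      have : ∀ a, (1 - (2/5 : ℝ) • Matrix.vecMulVec
        (Pi.single p 1 + Pi.single q 2 : Fin n → ℝ) (Pi.single p 1 + Pi.single q 2)) p a * f a
        = (if p = a then 3/5 * f p else 0) - (if q = a then 4/5 * f q else 0) := by
        intro a
        simp only [Matrix.sub_apply, Matrix.smul_apply, Matrix.vecMulVec_apply, Matrix.one_apply,
          Pi.add_apply, Pi.single_apply, smul_eq_mul]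
        by_cases ha : p = a
        · subst ha; simp [hpq, hpq.symm]; left; norm_num
        · by_cases hb : q = a
          · subst hb; simp [hpq, hpq.symm]; left; norm_num
          · simp [ha, hb, Ne.symm ha, Ne.symm hb, hpq]
      simp only [this, Finset.sum_sub_distrib, Finset.sum_ite_eq, Finset.mem_univ, if_true]
    simp only [hrow] at key
    have e1 := h1 q p hpq.symm
    have e2 := h2 q p hpq.symm
    have e3 := h3 q p hpq.symm
    have e4 := h4 q
    have z1 := hsign p p q q q
    have z2 := hsign p q p q q
    have z3 := hsign p q q p q
    have z4 := hsign p q q q p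
    have z5 := hsign p q p p p
    have z6 := hsign p p q p p
    have z7 := hsign p p p q p
    have z8 := hsign p p p p q
    simp [hpq, hpq.symm] at z1 z2 z3 z4 z5 z6 z7 z8
    linarith
  unfold kdelta
  have sr := hsign r r s t u
  have ss := hsign s r s t u
  have st := hsign t r s t u
  have su := hsign u r s t u
  by_cases a1 : r = s
  · subst a1
    by_cases a2 : t = u
    · subst a2
      by_cases a3 : r = t
      · subst a3
        simp [h4, h5]
      · simp [a3, h1 r t a3]
    · by_cases a3 : r = t
      · subst a3
        simp [a2, Ne.symm a2] at su ⊢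
        linarith
      · simp [a2, Ne.symm a2, a3, Ne.symm a3] at st ⊢
        linarith
  · by_cases a2 : r = t
    · subst a2
      by_cases a3 : s = u
      · subst a3
        simp [a1, h2 r s a1]
      · simp [a1, Ne.symm a1, a3, Ne.symm a3] at ss ⊢
        linarith
    · by_cases a3 : r = u
      · subst a3
        by_cases a4 : s = t
        · subst a4
          simp [a1, h3 r s a1]
        · simp [a1, Ne.symm a1, a2, Ne.symm a2, a4, Ne.symm a4] at ss ⊢
          linarith
      · simp [a1, Ne.symm a1, a2, Ne.symm a2, a3, Ne.symm a3] at sr ⊢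
        linarith

theorem orth_integrable {n : ℕ}
    [MeasurableSpace (Matrix.orthogonalGroup (Fin n) ℝ)]
    [BorelSpace (Matrix.orthogonalGroup (Fin n) ℝ)]
    (μ : Measure (Matrix.orthogonalGroup (Fin n) ℝ)) [IsProbabilityMeasure μ]
    (r s t u i j k l : Fin n) :
    Integrable (fun H : Matrix.orthogonalGroup (Fin n) ℝ =>
      ((H : Matrix (Fin n) (Fin n) ℝ) r i) * ((H : Matrix (Fin n) (Fin n) ℝ) s j)
        * ((H : Matrix (Fin n) (Fin n) ℝ) t k) * ((H : Matrix (Fin n) (Fin n) ℝ) u l)) μ := by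
  have hc : ∀ r i, Continuous (fun H : Matrix.orthogonalGroup (Fin n) ℝ =>
      (H : Matrix (Fin n) (Fin n) ℝ) r i) := fun r i =>
    (continuous_subtype_val).matrix_elem r i
  refine Integrable.of_bound (C := 1)
    (((((hc r i).mul (hc s j)).mul (hc t k)).mul (hc u l)).aestronglyMeasurable) ?_
  refine Filter.Eventually.of_forall fun H => ?_
  have hb : ∀ r i, ‖(H : Matrix (Fin n) (Fin n) ℝ) r i‖ ≤ 1 := fun r i =>
    entry_norm_bound_of_unitary H.2 r i
  rw [norm_mul, norm_mul, norm_mul]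
  exact mul_le_one₀ (mul_le_one₀ (mul_le_one₀ (hb _ _) (norm_nonneg _) (hb _ _))
    (norm_nonneg _) (hb _ _)) (norm_nonneg _) (hb _ _)

theorem orth_inv {n : ℕ}
    [MeasurableSpace (Matrix.orthogonalGroup (Fin n) ℝ)]
    [BorelSpace (Matrix.orthogonalGroup (Fin n) ℝ)]
    (μ : Measure (Matrix.orthogonalGroup (Fin n) ℝ))
    [μ.IsHaarMeasure] [IsProbabilityMeasure μ] (i j k l : Fin n)
    (A : Matrix (Fin n) (Fin n) ℝ) (hA : A * Aᵀ = 1) (r s t u : Fin n) :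
    ∫ H, ((H : Matrix (Fin n) (Fin n) ℝ) r i) * ((H : Matrix (Fin n) (Fin n) ℝ) s j)
        * ((H : Matrix (Fin n) (Fin n) ℝ) t k) * ((H : Matrix (Fin n) (Fin n) ℝ) u l) ∂μ
     = ∑ a, A r a * ∑ b, A s b * ∑ c, A t c * ∑ d, A u d *
      ∫ H, ((H : Matrix (Fin n) (Fin n) ℝ) a i) * ((H : Matrix (Fin n) (Fin n) ℝ) b j)
        * ((H : Matrix (Fin n) (Fin n) ℝ) c k) * ((H : Matrix (Fin n) (Fin n) ℝ) d l) ∂μ := by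
  have hmem : A ∈ Matrix.orthogonalGroup (Fin n) ℝ := (Matrix.mem_orthogonalGroup_iff _ _).2 hA
  rw [← integral_mul_left_eq_self _ (⟨A, hmem⟩ : Matrix.orthogonalGroup (Fin n) ℝ)]
  have hI := fun r s t u => orth_integrable μ r s t u i j k l
  have : ∀ H : Matrix.orthogonalGroup (Fin n) ℝ,
    (((⟨A, hmem⟩ * H : Matrix.orthogonalGroup (Fin n) ℝ) : Matrix (Fin n) (Fin n) ℝ) r i) *
    (((⟨A, hmem⟩ * H : Matrix.orthogonalGroup (Fin n) ℝ) : Matrix (Fin n) (Fin n) ℝ) s j) *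
    (((⟨A, hmem⟩ * H : Matrix.orthogonalGroup (Fin n) ℝ) : Matrix (Fin n) (Fin n) ℝ) t k) *
    (((⟨A, hmem⟩ * H : Matrix.orthogonalGroup (Fin n) ℝ) : Matrix (Fin n) (Fin n) ℝ) u l)
    = ∑ a, A r a * ∑ b, A s b * ∑ c, A t c * ∑ d, A u d *
      (((H : Matrix (Fin n) (Fin n) ℝ) a i) * ((H : Matrix (Fin n) (Fin n) ℝ) b j)
        * ((H : Matrix (Fin n) (Fin n) ℝ) c k) * ((H : Matrix (Fin n) (Fin n) ℝ) d l)) := by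
    intro H
    have e : ∀ r i, ((⟨A, hmem⟩ * H : Matrix.orthogonalGroup (Fin n) ℝ) :
      Matrix (Fin n) (Fin n) ℝ) r i = ∑ a, A r a * (H : Matrix (Fin n) (Fin n) ℝ) a i :=
      fun r i => rfl
    simp only [e]
    rw [mul_assoc, mul_assoc, Finset.sum_mul]
    refine Finset.sum_congr rfl fun a _ => ?_
    rw [mul_assoc, Finset.sum_mul, Finset.mul_sum]
    congr 1
    refine Finset.sum_congr rfl fun b _ => ?_
    rw [Finset.sum_mul, mul_assoc, mul_left_comm, Finset.mul_sum, Finset.mul_sum]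
    congr 1
    refine Finset.sum_congr rfl fun c _ => ?_
    simp only [Finset.mul_sum]
    refine Finset.sum_congr rfl fun d _ => ?_
    ring
  simp only [this]
  have i1 : ∀ a b c, Integrable (fun H : Matrix.orthogonalGroup (Fin n) ℝ => ∑ d, A u d *
      (((H : Matrix (Fin n) (Fin n) ℝ) a i) * ((H : Matrix (Fin n) (Fin n) ℝ) b j)
        * ((H : Matrix (Fin n) (Fin n) ℝ) c k) * ((H : Matrix (Fin n) (Fin n) ℝ) d l))) μ :=
    fun a b c => integrable_finsetSum _ fun d _ => (hI a b c d).const_mul _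
  have i2 := fun a b => integrable_finsetSum (μ := μ) Finset.univ
    fun c _ => (i1 a b c).const_mul (A t c)
  have i3 := fun a => integrable_finsetSum (μ := μ) Finset.univ
    fun b _ => (i2 a b).const_mul (A s b)
  rw [integral_finsetSum _ fun a _ => (i3 a).const_mul _]
  refine Finset.sum_congr rfl fun a _ => ?_
  rw [integral_const_mul, integral_finsetSum _ fun b _ => (i2 a b).const_mul _]
  congr 1
  refine Finset.sum_congr rfl fun b _ => ?_
  rw [integral_const_mul, integral_finsetSum _ fun c _ => (i1 a b c).const_mul _]
  congr 1
  refine Finset.sum_congr rfl fun c _ => ?_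
  rw [integral_const_mul, integral_finsetSum _ fun d _ => (hI a b c d).const_mul _]
  congr 1
  refine Finset.sum_congr rfl fun d _ => ?_
  rw [integral_const_mul]

theorem orth_cols {n : ℕ} (H : Matrix.orthogonalGroup (Fin n) ℝ) (i j : Fin n) :
    ∑ a, (H : Matrix (Fin n) (Fin n) ℝ) a i * (H : Matrix (Fin n) (Fin n) ℝ) a j = kdelta i j := by
  have h := (Matrix.mem_orthogonalGroup_iff' _ _).1 H.2
  have h2 := congrFun (congrFun h i) j
  rw [Matrix.mul_apply, Matrix.one_apply] at h2
  exact h2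

/-- Fourth-order Haar moment formula on `O(n)`, `n ≥ 2`:
`E(H r i · H s j · H t k · H u l)` equals
`[(n+1)(δ_{rs}δ_{tu}δ^{ij}δ^{kl} + δ_{rt}δ_{su}δ^{ik}δ^{jl} + δ_{ru}δ_{st}δ^{il}δ^{jk})
  - (six cross terms)] / (n(n-1)(n+2))`. -/
theorem haar_fourth_moment_orthogonal {n : ℕ} (hn : 2 ≤ n)
    [MeasurableSpace (Matrix.orthogonalGroup (Fin n) ℝ)]
    [BorelSpace (Matrix.orthogonalGroup (Fin n) ℝ)]
    (μ : Measure (Matrix.orthogonalGroup (Fin n) ℝ))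
    [μ.IsHaarMeasure] [IsProbabilityMeasure μ]
    (r s t u i j k l : Fin n) :
    ∫ H, ((H : Matrix (Fin n) (Fin n) ℝ) r i) * ((H : Matrix (Fin n) (Fin n) ℝ) s j)
        * ((H : Matrix (Fin n) (Fin n) ℝ) t k) * ((H : Matrix (Fin n) (Fin n) ℝ) u l) ∂μ
      = (((n : ℝ) + 1) *
            (kdelta r s * kdelta t u * kdelta i j * kdelta k l
              + kdelta r t * kdelta s u * kdelta i k * kdelta j l
              + kdelta r u * kdelta s t * kdelta i l * kdelta j k)
          - (kdelta r s * kdelta t u * kdelta i k * kdelta j l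
              + kdelta r s * kdelta t u * kdelta i l * kdelta j k
              + kdelta r t * kdelta s u * kdelta i j * kdelta k l
              + kdelta r t * kdelta s u * kdelta i l * kdelta j k
              + kdelta r u * kdelta s t * kdelta i j * kdelta k l
              + kdelta r u * kdelta s t * kdelta i k * kdelta j l))
        / ((n : ℝ) * ((n : ℝ) - 1) * ((n : ℝ) + 2)) := by
  have hI := fun r s t u => orth_integrable μ r s t u i j k l
  have hiso := isotropic_four (fun r s t u =>
    ∫ H, ((H : Matrix (Fin n) (Fin n) ℝ) r i) * ((H : Matrix (Fin n) (Fin n) ℝ) s j)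
        * ((H : Matrix (Fin n) (Fin n) ℝ) t k) * ((H : Matrix (Fin n) (Fin n) ℝ) u l) ∂μ)
    (fun A hA r s t u => orth_inv μ i j k l A hA r s t u)
    ⟨0, by omega⟩ ⟨1, by omega⟩ (by simp)
  obtain ⟨a, b, c, habc⟩ : ∃ a b c : ℝ, ∀ r s t u : Fin n,
    ∫ H, ((H : Matrix (Fin n) (Fin n) ℝ) r i) * ((H : Matrix (Fin n) (Fin n) ℝ) s j)
        * ((H : Matrix (Fin n) (Fin n) ℝ) t k) * ((H : Matrix (Fin n) (Fin n) ℝ) u l) ∂μ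
      = a * (kdelta r s * kdelta t u) + b * (kdelta r t * kdelta s u)
        + c * (kdelta r u * kdelta s t) := ⟨_, _, _, hiso⟩
  have A1 : ∑ x, ∑ y, ∫ H, ((H : Matrix (Fin n) (Fin n) ℝ) x i) *
      ((H : Matrix (Fin n) (Fin n) ℝ) x j) * ((H : Matrix (Fin n) (Fin n) ℝ) y k) *
      ((H : Matrix (Fin n) (Fin n) ℝ) y l) ∂μ = kdelta i j * kdelta k l := by
    have e : ∀ x, ∑ y, ∫ H, ((H : Matrix (Fin n) (Fin n) ℝ) x i) *
      ((H : Matrix (Fin n) (Fin n) ℝ) x j) * ((H : Matrix (Fin n) (Fin n) ℝ) y k) *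
      ((H : Matrix (Fin n) (Fin n) ℝ) y l) ∂μ = ∫ H, ∑ y, ((H : Matrix (Fin n) (Fin n) ℝ) x i) *
      ((H : Matrix (Fin n) (Fin n) ℝ) x j) * ((H : Matrix (Fin n) (Fin n) ℝ) y k) *
      ((H : Matrix (Fin n) (Fin n) ℝ) y l) ∂μ := fun x =>
      (integral_finsetSum _ fun y _ => hI x x y y).symm
    simp_rw [e]
    rw [← integral_finsetSum _ fun x _ => integrable_finsetSum _ fun y _ => hI x x y y]
    rw [integral_congr_ae (g := fun _ => kdelta i j * kdelta k l) (Filter.Eventually.of_forall fun H => ?_)]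
    · simp
    · simp only [← orth_cols H, Finset.sum_mul_sum]
      refine Finset.sum_congr rfl fun x _ => Finset.sum_congr rfl fun y _ => ?_
      ring
  simp only [habc] at A1
  have A2 : ∑ x, ∑ y, ∫ H, ((H : Matrix (Fin n) (Fin n) ℝ) x i) *
      ((H : Matrix (Fin n) (Fin n) ℝ) y j) * ((H : Matrix (Fin n) (Fin n) ℝ) x k) *
      ((H : Matrix (Fin n) (Fin n) ℝ) y l) ∂μ = kdelta i k * kdelta j l := by
    have e : ∀ x, ∑ y, ∫ H, ((H : Matrix (Fin n) (Fin n) ℝ) x i) *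
      ((H : Matrix (Fin n) (Fin n) ℝ) y j) * ((H : Matrix (Fin n) (Fin n) ℝ) x k) *
      ((H : Matrix (Fin n) (Fin n) ℝ) y l) ∂μ = ∫ H, ∑ y, ((H : Matrix (Fin n) (Fin n) ℝ) x i) *
      ((H : Matrix (Fin n) (Fin n) ℝ) y j) * ((H : Matrix (Fin n) (Fin n) ℝ) x k) *
      ((H : Matrix (Fin n) (Fin n) ℝ) y l) ∂μ := fun x =>
      (integral_finsetSum _ fun y _ => hI x y x y).symm
    simp_rw [e]
    rw [← integral_finsetSum _ fun x _ => integrable_finsetSum _ fun y _ => hI x y x y]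
    rw [integral_congr_ae (g := fun _ => kdelta i k * kdelta j l) (Filter.Eventually.of_forall fun H => ?_)]
    · simp
    · simp only [← orth_cols H, Finset.sum_mul_sum]
      refine Finset.sum_congr rfl fun x _ => Finset.sum_congr rfl fun y _ => ?_
      ring
  simp only [habc] at A2
  have A3 : ∑ x, ∑ y, ∫ H, ((H : Matrix (Fin n) (Fin n) ℝ) x i) *
      ((H : Matrix (Fin n) (Fin n) ℝ) y j) * ((H : Matrix (Fin n) (Fin n) ℝ) y k) *
      ((H : Matrix (Fin n) (Fin n) ℝ) x l) ∂μ = kdelta i l * kdelta j k := by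
    have e : ∀ x, ∑ y, ∫ H, ((H : Matrix (Fin n) (Fin n) ℝ) x i) *
      ((H : Matrix (Fin n) (Fin n) ℝ) y j) * ((H : Matrix (Fin n) (Fin n) ℝ) y k) *
      ((H : Matrix (Fin n) (Fin n) ℝ) x l) ∂μ = ∫ H, ∑ y, ((H : Matrix (Fin n) (Fin n) ℝ) x i) *
      ((H : Matrix (Fin n) (Fin n) ℝ) y j) * ((H : Matrix (Fin n) (Fin n) ℝ) y k) *
      ((H : Matrix (Fin n) (Fin n) ℝ) x l) ∂μ := fun x =>
      (integral_finsetSum _ fun y _ => hI x y y x).symm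
    simp_rw [e]
    rw [← integral_finsetSum _ fun x _ => integrable_finsetSum _ fun y _ => hI x y y x]
    rw [integral_congr_ae (g := fun _ => kdelta i l * kdelta j k) (Filter.Eventually.of_forall fun H => ?_)]
    · simp
    · simp only [← orth_cols H, Finset.sum_mul_sum]
      refine Finset.sum_congr rfl fun x _ => Finset.sum_congr rfl fun y _ => ?_
      ring
  simp only [habc] at A3
  have d1 : ∀ x : Fin n, kdelta x x = 1 := fun x => by simp [kdelta]
  have d2 : ∀ x y : Fin n, kdelta x y * kdelta x y = kdelta x y := fun x y => by simp [kdelta]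
  have d3 : ∀ x y : Fin n, kdelta x y * kdelta y x = kdelta x y := fun x y => by
    simp [kdelta, eq_comm]
  have d4 : ∀ x : Fin n, ∑ y, kdelta x y = 1 := fun x => by simp [kdelta]
  simp only [d1, d2, d3, d4, Finset.sum_add_distrib, ← Finset.mul_sum, mul_one, Finset.sum_const,
    Finset.card_univ, Fintype.card_fin, nsmul_eq_mul] at A1 A2 A3
  have hn' : (2 : ℝ) ≤ n := by exact_mod_cast hn
  have n0 : (n : ℝ) ≠ 0 := by positivity
  have n1 : (n : ℝ) - 1 ≠ 0 := by linarith
  have n2 : (n : ℝ) + 2 ≠ 0 := by positivity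
  rw [habc, eq_div_iff (by positivity)]
  have a1 : a * (n * (n - 1) * (n + 2)) = (n + 1) * (kdelta i j * kdelta k l)
      - kdelta i k * kdelta j l - kdelta i l * kdelta j k := by
    rw [← A1, ← A2, ← A3]; ring
  have b1 : b * (n * (n - 1) * (n + 2)) = (n + 1) * (kdelta i k * kdelta j l)
      - kdelta i j * kdelta k l - kdelta i l * kdelta j k := by
    rw [← A1, ← A2, ← A3]; ring
  have c1 : c * (n * (n - 1) * (n + 2)) = (n + 1) * (kdelta i l * kdelta j k)
      - kdelta i j * kdelta k l - kdelta i k * kdelta j l := by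
    rw [← A1, ← A2, ← A3]; ring
  linear_combination (kdelta r s * kdelta t u) * a1 + (kdelta r t * kdelta s u) * b1
    + (kdelta r u * kdelta s t) * c1
end

section
/- Let Y be an n×k real matrix (k ≤ n) whose top k×k block ĝ = Y⁽ᵏ⁾ is invertible, and set Z = Y ĝ⁻¹. The Jacobian determinant of the change of variables Y ↦ (ĝ, Z) (where Z ranges over n×k matrices with top block equal to Iₖ and ĝ over GL(k)) is |det ĝ|^{n-k}. -/
open Matrix MeasureTheory


/-- Lebesgue measure on matrices, via the identification with `Fin a → Fin b → ℝ`. -/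
noncomputable instance matrixMeasureSpace (a b : ℕ) :
    MeasureSpace (Matrix (Fin a) (Fin b) ℝ) :=
  inferInstanceAs (MeasureSpace (Fin a → Fin b → ℝ))

/-- The `n×k` matrix `Y = Z ĝ` built from a top `k×k` block `g = ĝ` and the free
bottom `(n-k)×k` block `B` of `Z` (whose top block is `Iₖ`): row `i` of `Y` is the
`i`-th row of `g` if `i < k` and the `(i-k)`-th row of `B * g` otherwise. -/
noncomputable def stackY (n k : ℕ) (g : Matrix (Fin k) (Fin k) ℝ)
    (B : Matrix (Fin (n - k)) (Fin k) ℝ) : Matrix (Fin n) (Fin k) ℝ :=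
  Matrix.of fun i j =>
    if h : (i : ℕ) < k then g ⟨i, h⟩ j
    else (B * g) ⟨(i : ℕ) - k, by omega⟩ j

theorem aux_det_ae (k : ℕ) :
    ∀ᵐ g : Fin k → Fin k → ℝ, (Matrix.of g).det ≠ 0 := by
  have hcont : Continuous fun p : (Fin k → Fin k → ℝ) × ℝ =>
      (Matrix.of p.1 + p.2 • (1 : Matrix (Fin k) (Fin k) ℝ)).det := by
    apply Continuous.matrix_det
    refine Continuous.add (f := fun p : (Fin k → Fin k → ℝ) × ℝ => Matrix.of p.1) ?_ ?_
    · exact continuous_fst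
    · exact continuous_snd.smul continuous_const
  have hm : MeasurableSet {p : (Fin k → Fin k → ℝ) × ℝ |
      (Matrix.of p.1 + p.2 • (1 : Matrix (Fin k) (Fin k) ℝ)).det ≠ 0} :=
    (isOpen_ne_fun hcont continuous_const).measurableSet
  have h1 : ∀ᵐ g : Fin k → Fin k → ℝ, ∀ᵐ t : ℝ,
      (Matrix.of g + t • (1 : Matrix (Fin k) (Fin k) ℝ)).det ≠ 0 := by
    refine Filter.Eventually.of_forall fun g => ?_
    have hfin : ((-Matrix.of g).charpoly.rootSet ℝ).Finite := Polynomial.rootSet_finite _ _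
    rw [ae_iff]
    refine measure_mono_null ?_ (hfin.measure_zero volume)
    intro t ht
    simp only [ne_eq, not_not, Set.mem_ofPred_eq] at ht
    rw [Polynomial.mem_rootSet]
    refine ⟨(Matrix.charpoly_monic _).ne_zero, ?_⟩
    rw [Polynomial.coe_aeval_eq_eval, Matrix.eval_charpoly, ← ht]
    congr 1
    rw [Matrix.scalar_apply, ← Matrix.smul_one_eq_diagonal]
    abel
  rw [Measure.ae_ae_comm hm] at h1
  obtain ⟨t, ht⟩ := h1.exists
  exact (eventually_add_right_iff volume
    (show Fin k → Fin k → ℝ from t • (1 : Matrix (Fin k) (Fin k) ℝ))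
    (p := fun g : Fin k → Fin k → ℝ => (Matrix.of g).det ≠ 0)).1 ht

theorem aux_mul (m k : ℕ) (g : Matrix (Fin k) (Fin k) ℝ) (hg : g.det ≠ 0)
    (F : (Fin m → Fin k → ℝ) → ENNReal) (hF : Measurable F) :
    ∫⁻ C, F C = ∫⁻ B : Fin m → Fin k → ℝ,
      F (fun i => g.vecMul (B i) ) * ENNReal.ofReal (|g.det| ^ m) := by
  let L : (Fin m → Fin k → ℝ) →ₗ[ℝ] (Fin m → Fin k → ℝ) :=
    LinearMap.pi (fun i => (Matrix.toLin' gᵀ).comp (LinearMap.proj i))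
  have hL : LinearMap.det L = g.det ^ m := by
    simp only [L]
    rw [LinearMap.det_pi]
    simp [LinearMap.det_toLin']
  have hL0 : LinearMap.det L ≠ 0 := by rw [hL]; exact pow_ne_zero _ hg
  have hLa : ∀ B : Fin m → Fin k → ℝ, L B = fun i => g.vecMul (B i) := by
    intro B
    funext i
    simp [L, Matrix.mulVec_transpose]
  have hmap := Measure.map_linearMap_addHaar_eq_smul_addHaar
    (volume : Measure (Fin m → Fin k → ℝ)) hL0
  have hLm : Measurable L := L.continuous_of_finiteDimensional.measurable
  have key := lintegral_map (μ := volume) hF hLm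
  rw [hmap, lintegral_smul_measure, hL] at key
  simp only [hLa] at key
  have hFm : Measurable fun B : Fin m → Fin k → ℝ => F (fun i => g.vecMul (B i)) := by
    have := hF.comp hLm
    simpa only [Function.comp_def, hLa] using this
  rw [lintegral_mul_const _ hFm, ← key, smul_eq_mul, mul_comm, ← mul_assoc,
    ← ENNReal.ofReal_mul (by positivity), abs_inv, abs_pow,
    mul_inv_cancel₀ (pow_ne_zero _ (abs_ne_zero.2 hg)), ENNReal.ofReal_one, one_mul]

theorem aux_split {n k : ℕ} (hk : k ≤ n)
    (f : (Fin n → Fin k → ℝ) → ENNReal) (hf : Measurable f) :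
    ∫⁻ Y, f Y = ∫⁻ g : Fin k → Fin k → ℝ, ∫⁻ C : Fin (n - k) → Fin k → ℝ,
      f (fun i => if h : (i : ℕ) < k then g ⟨i, h⟩ else C ⟨(i : ℕ) - k, by omega⟩) := by
  let e : Fin k ⊕ Fin (n - k) ≃ Fin n := finSumFinEquiv.trans (finCongr (by omega))
  have h1 := (volume_measurePreserving_piCongrLeft (fun _ : Fin n => Fin k → ℝ) e)
  have h2 := (volume_measurePreserving_sumPiEquivProdPi_symm
    (fun _ : Fin k ⊕ Fin (n - k) => Fin k → ℝ))
  have h3 := h1.comp h2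
  rw [← h3.lintegral_comp hf]
  erw [lintegral_prod _ (hf.comp h3.measurable).aemeasurable]
  refine lintegral_congr fun g => lintegral_congr fun C => ?_
  simp only [Function.comp]
  congr 1
  funext i
  obtain ⟨j, rfl⟩ := e.surjective i
  rcases j with j | j
  · erw [Equiv.piCongrLeft_sumInl]
    simp [e]
  · erw [Equiv.piCongrLeft_sumInr]
    simp [e]

/-- Change of variables `Y ↦ (ĝ, Z)` for `n×k` matrices (`k ≤ n`), where `ĝ` is the
top `k×k` block of `Y` and `Z = Y ĝ⁻¹` has top block `Iₖ`: the Jacobian determinant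
of the transformation is `|det ĝ|^{n-k}`, i.e. Lebesgue integration over `Y`
corresponds to integration over `(g, B)` weighted by `|det g|^{n-k}`. -/
theorem jacobian_stack {n k : ℕ} (hk : k ≤ n)
    (f : Matrix (Fin n) (Fin k) ℝ → ENNReal) (hf : Measurable f) :
    ∫⁻ Y, f Y ∂(volume : Measure (Matrix (Fin n) (Fin k) ℝ))
      = ∫⁻ g : Matrix (Fin k) (Fin k) ℝ,
          ∫⁻ B : Matrix (Fin (n - k)) (Fin k) ℝ,
            f (stackY n k g B) * ENNReal.ofReal (|g.det| ^ (n - k))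
          ∂volume ∂volume := by
  refine (aux_split hk f hf).trans ?_
  refine lintegral_congr_ae ?_
  filter_upwards [aux_det_ae k] with g hg
  refine (aux_mul (n - k) k (Matrix.of g) hg _ (hf.comp ?_)).trans ?_
  · refine measurable_pi_lambda _ fun i => ?_
    by_cases h : (i : ℕ) < k
    · simp only [h, dite_true]; exact measurable_const
    · simp only [h, dite_false]; exact measurable_pi_apply _
  · refine lintegral_congr fun B => ?_
    refine congrArg (fun y => f y * ENNReal.ofReal (|(Matrix.of g).det| ^ (n - k))) ?_
    funext i j
    simp only [stackY]
    by_cases h : (i : ℕ) < k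
    · simp [h]
    · simp [h]
      rfl
end
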